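/- There exist N̄ > 4π and a constant C > 0 such that for every open bounded convex set Ω ⊂ ℝ² with N(Ω) ≥ N̄ and every λ ∈ (0, max(8π, π² N(Ω)/496 − C)], the problem P(λ,Ω) admits a solution. -/

import Mathlib

open MeasureTheory Real Set Filter

noncomputable section

/-- The Euclidean plane ℝ². -/
abbrev R2 : Type := EuclideanSpace ℝ (Fin 2)

/-- The Laplacian of `u : R2 → ℝ`: the sum of the second derivatives of `u`
along the two coordinate axes. -/
def lap (u : R2 → ℝ) (p : R2) : ℝ :=
  ∑ i : Fin 2, iteratedDeriv 2 (fun t : ℝ => u (p + t • EuclideanSpace.single i (1 : ℝ))) 0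

/-- `u` is a solution of the mean field problem `P(λ, Ω)`:
`u ∈ C²(Ω) ∩ C⁰(cl Ω)`, `u = 0` on `∂Ω` and `-Δu = λ eᵘ / ∫_Ω eᵘ` in `Ω`. -/
def IsSolP (Ω : Set R2) (lam : ℝ) (u : R2 → ℝ) : Prop :=
  ContDiffOn ℝ 2 u Ω ∧ ContinuousOn u (closure Ω) ∧
    (∀ p ∈ frontier Ω, u p = 0) ∧
    ∀ p ∈ Ω, -lap u p = lam * Real.exp (u p) / ∫ q in Ω, Real.exp (u q)

/-- The isoperimetric ratio `N(Ω) = L(∂Ω)² / A(Ω)`, with `L(∂Ω)` the one-dimensional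
Hausdorff measure of the boundary and `A(Ω)` the Lebesgue area. -/
def isoRatio (Ω : Set R2) : ℝ :=
  (μH[1] (frontier Ω)).toReal ^ 2 / (volume Ω).toReal

/-- The average of `u` over the four points at distance `ε` from `x` along the axes. -/
def axisAvg (ε : ℝ) (u : R2 → ℝ) (x : R2) : ℝ :=
  (∑ i : Fin 2, (u (x + ε • EuclideanSpace.single i (1 : ℝ)) +
    u (x - ε • EuclideanSpace.single i (1 : ℝ)))) / 4

lemma inner_axis_step (ν x : R2) (ε : ℝ) (i : Fin 2) :
    inner ℝ ν (x + ε • EuclideanSpace.single i (1 : ℝ)) = inner ℝ ν x + ε * ν i ∧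
    inner ℝ ν (x - ε • EuclideanSpace.single i (1 : ℝ)) = inner ℝ ν x - ε * ν i := by
  constructor
  · rw [inner_add_right, inner_smul_right, EuclideanSpace.inner_single_right]; simp
  · rw [inner_sub_right, inner_smul_right, EuclideanSpace.inner_single_right]; simp

lemma sq_coord_sum {ν : R2} (hν : ‖ν‖ = 1) : ν 0 ^ 2 + ν 1 ^ 2 = 1 := by
  have h := EuclideanSpace.norm_sq_eq ν
  rw [hν] at h
  simpa [Fin.sum_univ_two] using h.symm

lemma abs_coord_le {ν : R2} (hν : ‖ν‖ = 1) (i : Fin 2) : |ν i| ≤ 1 := by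
  have h := sq_coord_sum hν
  rw [abs_le_one_iff_mul_self_le_one]
  fin_cases i <;> simp <;> nlinarith [sq_nonneg (ν 0), sq_nonneg (ν 1)]

/-- Comparison with a parabola across a strip, for functions that are almost
dominated by their axis averages. -/
lemma axisAvg_comparison {O : Set R2} {ν : R2} (hν : ‖ν‖ = 1) {a b ε : ℝ} (hε : 0 < ε)
    (hO : ∀ x ∈ O, a ≤ inner ℝ ν x ∧ inner ℝ ν x ≤ b) {d : R2 → ℝ} {K : ℝ}
    (hK : ∀ x, d x ≤ K) {γ β : ℝ} (hγ : ∀ x, x ∉ O → d x ≤ γ) (hβ : 0 ≤ β)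
    (h : ∀ x ∈ O, d x ≤ axisAvg ε d x + ε ^ 2 / 4 * β) {x : R2} (hx : x ∈ O) :
    d x ≤ γ + β / 2 * ((inner ℝ ν x - a + ε) * (b + ε - inner ℝ ν x)) := by
  have key : ∀ δ : ℝ, 0 < δ →
      d x ≤ γ + (β + δ) / 2 * ((inner ℝ ν x - a + ε) * (b + ε - inner ℝ ν x)) := by
    intro δ hδ
    set U : R2 → ℝ := fun y =>
      (β + δ) / 2 * ((inner ℝ ν y - a + ε) * (b + ε - inner ℝ ν y)) with hU
    set z : R2 → ℝ := fun y => d y - γ - U y with hz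
    have hzavg : ∀ y ∈ O, z y ≤ axisAvg ε z y - ε ^ 2 / 4 * δ := by
      intro y hy
      have h1 := h y hy
      have h2 := sq_coord_sum hν
      have h3 : axisAvg ε z y = axisAvg ε d y - γ - U y + ε ^ 2 / 4 * (β + δ) := by
        simp only [axisAvg, hz, hU, Fin.sum_univ_two, (inner_axis_step _ _ _ _).1,
          (inner_axis_step _ _ _ _).2]
        linear_combination (β + δ) * ε ^ 2 / 4 * h2
      rw [h3]
      simp only [hz]
      linarith
    have hnb : ∀ y ∈ O, ∀ y', (a - ε ≤ inner ℝ ν y' ∧ inner ℝ ν y' ≤ b + ε) → y' ∉ O →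
        z y' ≤ 0 := by
      intro y hy y' hy' hyO
      have h1 := hγ y' hyO
      have h2 : 0 ≤ U y' := by
        simp only [hU]
        have : 0 ≤ (inner ℝ ν y' - a + ε) * (b + ε - inner ℝ ν y') :=
          mul_nonneg (by linarith) (by linarith)
        positivity
      simp only [hz]; linarith
    have hUO : ∀ y ∈ O, 0 ≤ U y := by
      intro y hy
      have := hO y hy
      simp only [hU]
      have : 0 ≤ (inner ℝ ν y - a + ε) * (b + ε - inner ℝ ν y) :=
        mul_nonneg (by linarith) (by linarith)
      positivity
    have hbdd : BddAbove (z '' O) := by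
      refine ⟨K - γ, ?_⟩
      rintro _ ⟨y, hy, rfl⟩
      have := hUO y hy
      have := hK y
      simp only [hz]; linarith
    suffices hzx : z x ≤ 0 by simp only [hz, hU] at hzx; linarith
    by_contra hcon
    push Not at hcon
    set S := sSup (z '' O) with hS
    have hSx : z x ≤ S := le_csSup hbdd ⟨x, hx, rfl⟩
    obtain ⟨_, ⟨y, hy, rfl⟩, hyS⟩ := exists_lt_of_lt_csSup (s := z '' O) ⟨_, x, hx, rfl⟩
      (show S - ε ^ 2 / 8 * δ < S by have : 0 < ε ^ 2 / 8 * δ := by positivity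
                                     linarith)
    have hbound : ∀ y', (a - ε ≤ inner ℝ ν y' ∧ inner ℝ ν y' ≤ b + ε) → z y' ≤ S := by
      intro y' hy'
      by_cases hy'O : y' ∈ O
      · exact le_csSup hbdd ⟨y', hy'O, rfl⟩
      · exact (hnb y hy y' hy' hy'O).trans (hcon.le.trans hSx)
    have hstep : ∀ i : Fin 2, z (y + ε • EuclideanSpace.single i (1 : ℝ)) ≤ S ∧
        z (y - ε • EuclideanSpace.single i (1 : ℝ)) ≤ S := by
      intro i
      have h1 := abs_le.1 (abs_coord_le hν i)
      have h2 := hO y hy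
      have h3 : -ε ≤ ε * ν i := by nlinarith
      have h4 : ε * ν i ≤ ε := by nlinarith
      constructor
      · apply hbound; rw [(inner_axis_step _ _ _ _).1]; constructor <;> linarith
      · apply hbound; rw [(inner_axis_step _ _ _ _).2]; constructor <;> linarith
    have hle : axisAvg ε z y ≤ S := by
      simp only [axisAvg, Fin.sum_univ_two]
      linarith [(hstep 0).1, (hstep 0).2, (hstep 1).1, (hstep 1).2]
    have h5 := hzavg y hy
    have : 0 < ε ^ 2 * δ := by positivity
    linarith
  set q := (inner ℝ ν x - a + ε) * (b + ε - inner ℝ ν x)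
  have hlim : Tendsto (fun δ : ℝ => γ + (β + δ) / 2 * q) (nhdsWithin 0 (Ioi 0))
      (nhds (γ + (β + 0) / 2 * q)) := by
    apply Tendsto.mono_left _ nhdsWithin_le_nhds
    exact Continuous.tendsto (by fun_prop) 0
  rw [add_zero] at hlim
  exact ge_of_tendsto hlim (eventually_nhdsWithin_of_forall key)

lemma parabola_le {a b ε s : ℝ} :
    (s - a + ε) * (b + ε - s) ≤ (b - a + 2 * ε) ^ 2 / 4 := by
  nlinarith [sq_nonneg (2 * s - a - b)]

lemma axisAvg_neg (ε : ℝ) (d : R2 → ℝ) (x : R2) :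
    axisAvg ε (fun y => -d y) x = -axisAvg ε d x := by
  simp only [axisAvg, Fin.sum_univ_two]; ring

/-- A priori bound for functions that almost satisfy the discrete equation, with an error
term of small Lipschitz size. -/
lemma abs_le_of_abs_sub_axisAvg_le {O : Set R2} {ν : R2} (hν : ‖ν‖ = 1) {a b ε B : ℝ}
    (hε : 0 < ε) (hO : ∀ x ∈ O, a ≤ inner ℝ ν x ∧ inner ℝ ν x ≤ b) (hB : 0 ≤ B)
    (hBH : B * (b - a + 2 * ε) ^ 2 / 8 ≤ 1 / 2) {d : R2 → ℝ} {K : ℝ}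
    (hK : ∀ x, |d x| ≤ K) {γ η : ℝ} (hη : 0 ≤ η)
    (hγ : ∀ x, x ∉ O → |d x| ≤ γ)
    (h : ∀ x ∈ O, |d x - axisAvg ε d x| ≤ ε ^ 2 / 4 * (B * |d x| + η)) (x : R2) :
    |d x| ≤ 2 * γ + η * (b - a + 2 * ε) ^ 2 / 4 := by
  set S := ⨆ x, |d x| with hS
  have hbdd : BddAbove (range fun x => |d x|) := ⟨K, by rintro _ ⟨y, rfl⟩; exact hK y⟩
  have hle : ∀ x, |d x| ≤ S := fun x => le_ciSup hbdd x
  have hS0 : 0 ≤ S := (abs_nonneg _).trans (hle 0)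
  have hβ : 0 ≤ B * S + η := by positivity
  have hε2 : 0 ≤ ε ^ 2 / 4 := by positivity
  have hmono : ∀ x ∈ O, |d x - axisAvg ε d x| ≤ ε ^ 2 / 4 * (B * S + η) := by
    intro x hx
    refine (h x hx).trans ?_
    have := hle x
    gcongr
  have hmain : ∀ x, |d x| ≤ γ + (B * S + η) / 2 * ((b - a + 2 * ε) ^ 2 / 4) := by
    intro x
    by_cases hx : x ∈ O
    · have h1 := axisAvg_comparison hν hε hO (d := d) (K := K)
        (fun x => (le_abs_self _).trans (hK x))
        (fun x hx => (le_abs_self _).trans (hγ x hx)) hβ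
        (fun x hx => by have := (abs_le.1 (hmono x hx)).2; linarith) hx
      have h2 := axisAvg_comparison hν hε hO (d := fun y => -d y) (K := K)
        (fun x => (neg_le_abs _).trans (hK x))
        (fun x hx => (neg_le_abs _).trans (hγ x hx)) hβ
        (fun x hx => by
          have := (abs_le.1 (hmono x hx)).1
          rw [axisAvg_neg]; linarith) hx
      have h3 : (B * S + η) / 2 * ((inner ℝ ν x - a + ε) * (b + ε - inner ℝ ν x)) ≤
          (B * S + η) / 2 * ((b - a + 2 * ε) ^ 2 / 4) :=
        mul_le_mul_of_nonneg_left parabola_le (by positivity)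
      rw [abs_le]; constructor <;> linarith
    · have : 0 ≤ (B * S + η) / 2 * ((b - a + 2 * ε) ^ 2 / 4) := by positivity
      linarith [hγ x hx]
  have hSle : S ≤ γ + (B * S + η) / 2 * ((b - a + 2 * ε) ^ 2 / 4) := ciSup_le hmain
  have h4 : S * (B * (b - a + 2 * ε) ^ 2 / 8) ≤ S * (1 / 2) :=
    mul_le_mul_of_nonneg_left hBH hS0
  have := hle x
  nlinarith

/-- A solution, small in sup norm, of the discrete Dirichlet problem for `-Δu = μ eᵘ` on `Ω`
at scale `ε`. -/
structure IsDiscreteSol (Ω : Set R2) (ε μ : ℝ) (u : R2 → ℝ) : Prop where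
  measurable : Measurable u
  nonneg : ∀ x, 0 ≤ u x
  le_half : ∀ x, u x ≤ 1 / 2
  zero : ∀ x, x ∉ Ω → u x = 0
  eq : ∀ x ∈ Ω, u x = axisAvg ε u x + ε ^ 2 / 4 * (μ * exp (u x))

lemma axisAvg_mono {ε : ℝ} {u v : R2 → ℝ} (h : ∀ x, u x ≤ v x) (x : R2) :
    axisAvg ε u x ≤ axisAvg ε v x := by
  unfold axisAvg; gcongr <;> apply h

lemma axisAvg_nonneg {ε : ℝ} {u : R2 → ℝ} (h : ∀ x, 0 ≤ u x) (x : R2) :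
    0 ≤ axisAvg ε u x :=
  div_nonneg (Finset.sum_nonneg fun _ _ => add_nonneg (h _) (h _)) (by norm_num)

lemma measurable_axisAvg {ε : ℝ} {u : R2 → ℝ} (h : Measurable u) :
    Measurable (axisAvg ε u) := by
  unfold axisAvg
  exact (Finset.measurable_sum _ fun i _ => (h.comp (measurable_id.add_const _)).add
    (h.comp (measurable_id.sub_const _))).div_const _

/-- Monotone iteration for the discrete problem. -/
def discreteIter (Ω : Set R2) (ε μ : ℝ) : ℕ → R2 → ℝ
  | 0 => 0
  | n + 1 => Ω.indicator fun x => axisAvg ε (discreteIter Ω ε μ n) x +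
      ε ^ 2 / 4 * (μ * exp (discreteIter Ω ε μ n x))

section Strip

variable {Ω : Set R2} {ν : R2} {a b ε μ μ₁ : ℝ}

lemma discreteIter_nonneg (hμ : 0 ≤ μ) (n : ℕ) (x : R2) : 0 ≤ discreteIter Ω ε μ n x := by
  induction n generalizing x with
  | zero => exact le_rfl
  | succ n ih =>
    refine indicator_nonneg (fun y _ => ?_) x
    have := axisAvg_nonneg (ε := ε) ih y
    positivity

lemma discreteIter_le_succ (hμ : 0 ≤ μ) (n : ℕ) (x : R2) :
    discreteIter Ω ε μ n x ≤ discreteIter Ω ε μ (n + 1) x := by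
  induction n generalizing x with
  | zero => exact discreteIter_nonneg hμ 1 x
  | succ n ih =>
    refine indicator_le_indicator ?_
    have := axisAvg_mono (ε := ε) ih x
    have := ih x
    gcongr

lemma measurable_discreteIter (hΩ : MeasurableSet Ω) (n : ℕ) :
    Measurable (discreteIter Ω ε μ n) := by
  induction n with
  | zero => exact measurable_const
  | succ n ih =>
    exact ((measurable_axisAvg ih).add
      (((measurable_exp.comp ih).const_mul μ).const_mul _)).indicator hΩ

lemma discreteIter_le_half (hν : ‖ν‖ = 1) (hε : 0 < ε)
    (hO : ∀ x ∈ Ω, a ≤ inner ℝ ν x ∧ inner ℝ ν x ≤ b) (hμ : 0 ≤ μ)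
    (hB : μ * exp (1 / 2) * (b - a + 2 * ε) ^ 2 / 8 ≤ 1 / 2) (n : ℕ) (x : R2) :
    discreteIter Ω ε μ n x ≤ 1 / 2 := by
  induction n generalizing x with
  | zero => norm_num [discreteIter]
  | succ n ih =>
    by_cases hx : x ∈ Ω
    swap
    · simp [discreteIter, hx]
    have hβ : 0 ≤ μ * exp (1 / 2) := by positivity
    have hε2 : 0 ≤ ε ^ 2 / 4 := by positivity
    have hexp : ∀ y, ε ^ 2 / 4 * (μ * exp (discreteIter Ω ε μ n y)) ≤
        ε ^ 2 / 4 * (μ * exp (1 / 2)) := by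
      intro y
      have := ih y
      gcongr
    have h1 := axisAvg_comparison hν hε hO (d := discreteIter Ω ε μ (n + 1))
      (K := 1 / 2 + ε ^ 2 / 4 * (μ * exp (1 / 2))) (γ := 0) (β := μ * exp (1 / 2))
      (by
        intro y
        refine indicator_le' (g := fun _ => _) (fun y _ => ?_) (fun y _ => ?_) y
        · refine add_le_add ?_ (hexp y)
          refine (axisAvg_mono (v := fun _ => 1 / 2) ih y).trans ?_
          norm_num [axisAvg]
        · positivity)
      (by intro y hy; simp [discreteIter, hy]) hβ
      (by
        intro y hy
        have h2 : discreteIter Ω ε μ (n + 1) y = axisAvg ε (discreteIter Ω ε μ n) y +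
            ε ^ 2 / 4 * (μ * exp (discreteIter Ω ε μ n y)) := by
          simp [discreteIter, hy]
        rw [h2]
        exact add_le_add (axisAvg_mono (discreteIter_le_succ hμ n) y) (hexp y)) hx
    have h3 : μ * exp (1 / 2) / 2 * ((inner ℝ ν x - a + ε) * (b + ε - inner ℝ ν x)) ≤
        μ * exp (1 / 2) / 2 * ((b - a + 2 * ε) ^ 2 / 4) :=
      mul_le_mul_of_nonneg_left parabola_le (by positivity)
    linarith

lemma exists_isDiscreteSol (hΩ : MeasurableSet Ω) (hν : ‖ν‖ = 1) (hε : 0 < ε)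
    (hO : ∀ x ∈ Ω, a ≤ inner ℝ ν x ∧ inner ℝ ν x ≤ b) (hμ : 0 ≤ μ)
    (hB : μ * exp (1 / 2) * (b - a + 2 * ε) ^ 2 / 8 ≤ 1 / 2) :
    ∃ u, IsDiscreteSol Ω ε μ u := by
  have hle := discreteIter_le_half hν hε hO hμ hB
  have hlim : ∀ x, Tendsto (fun n => discreteIter Ω ε μ n x) atTop
      (nhds (⨆ n, discreteIter Ω ε μ n x)) := fun x =>
    tendsto_atTop_ciSup (monotone_nat_of_le_succ fun n => discreteIter_le_succ hμ n x)
      ⟨1 / 2, by rintro _ ⟨n, rfl⟩; exact hle n x⟩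
  refine ⟨fun x => ⨆ n, discreteIter Ω ε μ n x, ?_, ?_, ?_, ?_, ?_⟩
  · exact measurable_of_tendsto_metrizable (measurable_discreteIter hΩ) (tendsto_pi_nhds.2 hlim)
  · exact fun x => ge_of_tendsto' (hlim x) fun n => discreteIter_nonneg hμ n x
  · exact fun x => le_of_tendsto' (hlim x) fun n => hle n x
  · intro x hx
    have : ∀ n, discreteIter Ω ε μ n x = 0 := by
      rintro (_ | n) <;> simp [discreteIter, hx]
    simp [this]
  · intro x hx
    refine tendsto_nhds_unique ((tendsto_add_atTop_iff_nat 1).2 (hlim x)) ?_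
    have h1 : ∀ n, discreteIter Ω ε μ (n + 1) x = axisAvg ε (discreteIter Ω ε μ n) x +
        ε ^ 2 / 4 * (μ * exp (discreteIter Ω ε μ n x)) := by
      intro n; simp [discreteIter, hx]
    simp only [h1]
    refine Tendsto.add ?_ (((continuous_exp.tendsto _).comp (hlim x)).const_mul μ |>.const_mul _)
    exact (tendsto_finsetSum _ fun i _ => (hlim _).add (hlim _)).div_const 4

lemma abs_exp_sub_exp_le {s t : ℝ} (hs : s ≤ 1 / 2) (ht : t ≤ 1 / 2) :
    |exp s - exp t| ≤ exp (1 / 2) * |s - t| := by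
  wlog hst : t ≤ s generalizing s t
  · rw [abs_sub_comm, abs_sub_comm s]; exact this ht hs (le_of_not_ge hst)
  rw [abs_of_nonneg (sub_nonneg.2 (exp_le_exp.2 hst)), abs_of_nonneg (sub_nonneg.2 hst)]
  have h1 : exp t = exp s * exp (t - s) := by rw [← exp_add]; congr 1; ring
  have h2 := add_one_le_exp (t - s)
  have h3 := exp_le_exp.2 hs
  have h4 := exp_pos s
  have : exp s - exp t ≤ exp s * (s - t) := by rw [h1]; nlinarith
  nlinarith

/-- Linear growth from the boundary, by comparison in a supporting half-plane. -/
lemma IsDiscreteSol.le_of_notMem {u : R2 → ℝ} (hu : IsDiscreteSol Ω ε μ u) (hΩ : IsOpen Ω)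
    (hc : Convex ℝ Ω) {R : ℝ} (hR : ∀ x ∈ Ω, ‖x‖ ≤ R) (hR0 : 0 ≤ R) (hε : 0 < ε) (hε1 : ε ≤ 1)
    (hμ : 0 ≤ μ) (hμ₁ : μ ≤ μ₁) {x y : R2} (hy : y ∉ Ω) :
    u x ≤ μ₁ * exp (1 / 2) / 2 * (2 * R + 1) * (‖x - y‖ + ε) := by
  have hμ₁0 : 0 ≤ μ₁ := hμ.trans hμ₁
  by_cases hx : x ∈ Ω
  swap
  · rw [hu.zero x hx]; positivity
  obtain ⟨f, hf⟩ := geometric_hahn_banach_open_point hc hΩ hy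
  set w : R2 := (InnerProductSpace.toDual ℝ R2).symm f with hw
  have hwf : ∀ z, inner ℝ w z = f z := fun z => InnerProductSpace.toDual_symm_apply
  have hw0 : w ≠ 0 := by
    intro h0
    have h1 := hf x hx
    rw [← hwf, ← hwf, h0] at h1
    simp at h1
  have hwn : 0 < ‖w‖ := norm_pos_iff.2 hw0
  set n : R2 := ‖w‖⁻¹ • w with hn
  have hn1 : ‖n‖ = 1 := by rw [hn, norm_smul, norm_inv, norm_norm, inv_mul_cancel₀ hwn.ne']
  have hlt : ∀ z ∈ Ω, inner ℝ n z ≤ inner ℝ n y := by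
    intro z hz
    rw [hn, real_inner_smul_left, real_inner_smul_left, hwf, hwf]
    exact mul_le_mul_of_nonneg_left (hf z hz).le (by positivity)
  have habs : ∀ z : R2, |inner ℝ n z| ≤ ‖z‖ := by
    intro z
    have := abs_real_inner_le_norm n z
    rwa [hn1, one_mul] at this
  have hε2 : 0 ≤ ε ^ 2 / 4 := by positivity
  have h1 := axisAvg_comparison hn1 hε (O := Ω) (a := -R) (b := inner ℝ n y) (d := u)
    (K := 1 / 2) (γ := 0) (β := μ₁ * exp (1 / 2))
    (fun z hz => ⟨by have := abs_le.1 (habs z); linarith [hR z hz], hlt z hz⟩) hu.le_half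
    (fun z hz => (hu.zero z hz).le) (by positivity)
    (fun z hz => by
      have h2 := hu.eq z hz
      have h3 := hu.le_half z
      have : ε ^ 2 / 4 * (μ * exp (u z)) ≤ ε ^ 2 / 4 * (μ₁ * exp (1 / 2)) := by gcongr
      linarith) hx
  have h4 := abs_le.1 (habs x)
  have h5 := hR x hx
  have h6 : inner ℝ n y - inner ℝ n x ≤ ‖x - y‖ := by
    have := (abs_le.1 (habs (x - y))).1
    rw [inner_sub_right] at this
    linarith
  have h7 := hlt x hx
  have h8 : (inner ℝ n x - -R + ε) * (inner ℝ n y + ε - inner ℝ n x) ≤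
      (2 * R + 1) * (‖x - y‖ + ε) := by
    apply mul_le_mul <;> linarith
  calc u x ≤ _ := h1
    _ ≤ 0 + μ₁ * exp (1 / 2) / 2 * ((2 * R + 1) * (‖x - y‖ + ε)) := by gcongr
    _ = _ := by ring

lemma IsDiscreteSol.abs_sub_le {u : R2 → ℝ} (hu : IsDiscreteSol Ω ε μ u) (hΩ : IsOpen Ω)
    (hc : Convex ℝ Ω) {R : ℝ} (hR : ∀ x ∈ Ω, ‖x‖ ≤ R) (hR0 : 0 ≤ R) (hν : ‖ν‖ = 1) (hε : 0 < ε)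
    (hε1 : ε ≤ 1) (hO : ∀ x ∈ Ω, a ≤ inner ℝ ν x ∧ inner ℝ ν x ≤ b) (hμ : 0 ≤ μ)
    (hμ₁ : μ ≤ μ₁) (hB : μ₁ * exp (1 / 2) * (b - a + 2 * ε) ^ 2 / 8 ≤ 1 / 2) (x y : R2) :
    |u x - u y| ≤ μ₁ * exp (1 / 2) * (2 * R + 1) * (‖x - y‖ + ε) := by
  have hμ₁0 : 0 ≤ μ₁ := hμ.trans hμ₁
  set h : R2 := x - y with hh
  have h1 := abs_le_of_abs_sub_axisAvg_le (O := Ω ∩ {z | z + h ∈ Ω}) hν hε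
    (fun z hz => hO z hz.1) (B := μ₁ * exp (1 / 2)) (by positivity) hB
    (d := fun z => u (z + h) - u z) (K := 1 / 2)
    (γ := μ₁ * exp (1 / 2) / 2 * (2 * R + 1) * (‖h‖ + ε)) (η := 0)
    (fun z => by
      rw [abs_le]
      constructor <;>
      linarith [hu.nonneg z, hu.nonneg (z + h), hu.le_half z, hu.le_half (z + h)])
    le_rfl
    (fun z hz => by
      by_cases hz1 : z ∈ Ω
      · have hz2 : z + h ∉ Ω := fun h' => hz ⟨hz1, h'⟩
        have := hu.le_of_notMem hΩ hc hR hR0 hε hε1 hμ hμ₁ (x := z) hz2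
        rw [hu.zero _ hz2, zero_sub, abs_neg, abs_of_nonneg (hu.nonneg z)]
        simpa using this
      · have := hu.le_of_notMem hΩ hc hR hR0 hε hε1 hμ hμ₁ (x := z + h) hz1
        rw [hu.zero _ hz1, sub_zero, abs_of_nonneg (hu.nonneg _)]
        simpa using this)
    (fun z hz => by
      have e1 := hu.eq z hz.1
      have e2 := hu.eq (z + h) hz.2
      have e3 : axisAvg ε (fun z => u (z + h) - u z) z = axisAvg ε u (z + h) - axisAvg ε u z := by
        simp only [axisAvg, Fin.sum_univ_two, add_right_comm z h, sub_add_eq_add_sub]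
        ring
      have e4 : u (z + h) - u z - axisAvg ε (fun z => u (z + h) - u z) z =
          ε ^ 2 / 4 * (μ * (exp (u (z + h)) - exp (u z))) := by rw [e3]; linarith
      rw [e4, abs_mul, abs_mul, abs_of_nonneg hμ, abs_of_nonneg (by positivity : 0 ≤ ε ^ 2 / 4),
        add_zero, mul_assoc μ₁]
      have := abs_exp_sub_exp_le (hu.le_half (z + h)) (hu.le_half z)
      gcongr) y
  have h2 : y + h = x := by rw [hh]; abel
  simp only [h2] at h1
  linarith

lemma IsDiscreteSol.abs_sub_le_of_param {u v : R2 → ℝ} {μ' : ℝ} (hu : IsDiscreteSol Ω ε μ u)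
    (hv : IsDiscreteSol Ω ε μ' v) (hν : ‖ν‖ = 1) (hε : 0 < ε)
    (hO : ∀ x ∈ Ω, a ≤ inner ℝ ν x ∧ inner ℝ ν x ≤ b) (hμ : 0 ≤ μ)
    (hμ₁ : μ ≤ μ₁) (hB : μ₁ * exp (1 / 2) * (b - a + 2 * ε) ^ 2 / 8 ≤ 1 / 2) (x : R2) :
    |u x - v x| ≤ |μ - μ'| * exp (1 / 2) * (b - a + 2 * ε) ^ 2 / 4 := by
  have hμ₁0 : 0 ≤ μ₁ := hμ.trans hμ₁
  have h1 := abs_le_of_abs_sub_axisAvg_le (O := Ω) hν hε hO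
    (B := μ₁ * exp (1 / 2)) (by positivity) hB
    (d := fun z => u z - v z) (K := 1 / 2) (γ := 0) (η := |μ - μ'| * exp (1 / 2))
    (fun z => by
      rw [abs_le]
      constructor <;> linarith [hu.nonneg z, hv.nonneg z, hu.le_half z, hv.le_half z])
    (by positivity)
    (fun z hz => by simp [hu.zero z hz, hv.zero z hz])
    (fun z hz => by
      have e1 := hu.eq z hz
      have e2 := hv.eq z hz
      have e3 : axisAvg ε (fun z => u z - v z) z = axisAvg ε u z - axisAvg ε v z := by
        simp only [axisAvg, Fin.sum_univ_two]; ring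
      have e4 : u z - v z - axisAvg ε (fun z => u z - v z) z =
          ε ^ 2 / 4 * (μ * (exp (u z) - exp (v z)) + (μ - μ') * exp (v z)) := by
        rw [e3]; linarith
      rw [e4, abs_mul, abs_of_nonneg (by positivity : 0 ≤ ε ^ 2 / 4)]
      have h3 := abs_exp_sub_exp_le (hu.le_half z) (hv.le_half z)
      refine mul_le_mul_of_nonneg_left ((abs_add_le _ _).trans ?_) (by positivity)
      rw [abs_mul, abs_mul, abs_of_nonneg hμ, abs_of_pos (exp_pos (v z)), mul_assoc μ₁]
      have := hv.le_half z
      gcongr) x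
  simpa using h1

end Strip

local notation "axis" i => (EuclideanSpace.single i (1 : ℝ) : R2)

lemma hasDerivAt_line (e : R2) {G : Type*} [NormedAddCommGroup G] [NormedSpace ℝ G] {φ : R2 → G}
    {p : R2} {t : ℝ} (h : DifferentiableAt ℝ φ (p + t • e)) :
    HasDerivAt (fun t : ℝ => φ (p + t • e)) (fderiv ℝ φ (p + t • e) e) t := by
  have h1 : HasDerivAt (fun t : ℝ => p + t • e) e t := by
    simpa using ((hasDerivAt_id t).smul_const e).const_add p
  exact h.hasFDerivAt.comp_hasDerivAt t h1

/-- The partial derivative of `u` along the `i`-th axis. -/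
def partialDeriv (i : Fin 2) (u : R2 → ℝ) (x : R2) : ℝ := fderiv ℝ u x (axis i)

lemma ContDiff.partialDeriv {m n : WithTop ℕ∞} {u : R2 → ℝ} (hu : ContDiff ℝ n u)
    (hmn : m + 1 ≤ n) (i : Fin 2) : ContDiff ℝ m (partialDeriv i u) :=
  (hu.fderiv_right hmn).clm_apply contDiff_const

lemma HasCompactSupport.partialDeriv {u : R2 → ℝ} (hu : HasCompactSupport u) (i : Fin 2) :
    HasCompactSupport (partialDeriv i u) :=
  hu.fderiv_apply ℝ _

lemma lap_eq_sum_partialDeriv {u : R2 → ℝ} {p : R2} (hu : ContDiffAt ℝ 2 u p) :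
    lap u p = ∑ i : Fin 2, partialDeriv i (partialDeriv i u) p := by
  unfold lap
  refine Finset.sum_congr rfl fun i _ => ?_
  rw [iteratedDeriv_succ, iteratedDeriv_one]
  have h1 : ∀ᶠ x in nhds p, DifferentiableAt ℝ u x :=
    (hu.eventually (by simp)).mono fun x hx => hx.differentiableAt (by simp)
  have hcont : Tendsto (fun t : ℝ => p + t • axis i) (nhds 0) (nhds p) := by
    have : Continuous fun t : ℝ => p + t • axis i := by fun_prop
    simpa using this.tendsto 0
  have h2 : deriv (fun t : ℝ => u (p + t • axis i)) =ᶠ[nhds 0]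
      fun t => partialDeriv i u (p + t • axis i) :=
    (hcont.eventually h1).mono fun t ht => (hasDerivAt_line _ ht).deriv
  rw [h2.deriv_eq]
  have h3 : DifferentiableAt ℝ (partialDeriv i u) (p + (0 : ℝ) • axis i) := by
    rw [zero_smul, add_zero]
    exact ((hu.fderiv_right (m := 1) (by norm_num)).clm_apply contDiffAt_const).differentiableAt
      (by simp)
  simpa [partialDeriv] using (hasDerivAt_line (axis i) h3).deriv

lemma second_difference_le {g g' g'' : ℝ → ℝ} {M ε : ℝ} (hε : 0 ≤ ε)
    (h1 : ∀ t, HasDerivAt g (g' t) t) (h2 : ∀ t, HasDerivAt g' (g'' t) t)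
    (hM : ∀ t, |t| ≤ ε → g'' t ≤ M) : g ε + g (-ε) - 2 * g 0 ≤ M * ε ^ 2 := by
  have hneg : ∀ t : ℝ, HasDerivAt (fun t : ℝ => -t) (-1) t := fun t => hasDerivAt_neg t
  have hd1 : ∀ t, HasDerivAt (fun t => g' t - g' (-t) - 2 * M * t)
      (g'' t + g'' (-t) - 2 * M) t := fun t => by
    have := (((h2 t).sub ((h2 (-t)).comp t (hneg t))).sub ((hasDerivAt_id t).const_mul (2 * M)))
    refine this.congr_deriv ?_
    ring
  have hd0 : ∀ t, HasDerivAt (fun t => g t + g (-t) - M * t ^ 2)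
      (g' t - g' (-t) - 2 * M * t) t := fun t => by
    have := (((h1 t).add ((h1 (-t)).comp t (hneg t))).sub ((hasDerivAt_pow 2 t).const_mul M))
    refine this.congr_deriv ?_
    ring
  have ha1 : AntitoneOn (fun t => g' t - g' (-t) - 2 * M * t) (Icc 0 ε) := by
    refine antitoneOn_of_deriv_nonpos (convex_Icc 0 ε)
      (fun t _ => (hd1 t).continuousAt.continuousWithinAt)
      (fun t _ => (hd1 t).differentiableAt.differentiableWithinAt) fun t ht => ?_
    rw [interior_Icc] at ht
    rw [(hd1 t).deriv]
    have e1 := hM t (by rw [abs_of_pos ht.1]; exact ht.2.le)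
    have e2 := hM (-t) (by rw [abs_neg, abs_of_pos ht.1]; exact ht.2.le)
    linarith
  have ha0 : AntitoneOn (fun t => g t + g (-t) - M * t ^ 2) (Icc 0 ε) := by
    refine antitoneOn_of_deriv_nonpos (convex_Icc 0 ε)
      (fun t _ => (hd0 t).continuousAt.continuousWithinAt)
      (fun t _ => (hd0 t).differentiableAt.differentiableWithinAt) fun t ht => ?_
    rw [interior_Icc] at ht
    rw [(hd0 t).deriv]
    have := ha1 (left_mem_Icc.2 hε) (Ioo_subset_Icc_self ht) ht.1.le
    simpa using this
  have := ha0 (left_mem_Icc.2 hε) (right_mem_Icc.2 hε) hε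
  simp at this
  linarith

lemma exists_modulus {G : Type*} [NormedAddCommGroup G] {f : R2 → G} (hs : HasCompactSupport f)
    (hf : Continuous f) {δ : ℝ} (hδ : 0 < δ) :
    ∃ η > 0, ∀ x y, dist x y < η → ‖f x - f y‖ < δ := by
  obtain ⟨η, hη, h⟩ := Metric.uniformContinuous_iff.1 (hs.uniformContinuous_of_continuous hf) δ hδ
  exact ⟨η, hη, fun x y hxy => by simpa [dist_eq_norm] using h hxy⟩

/-- The discrete Laplacian at scale `ε`. -/
def discreteLap (ε : ℝ) (φ : R2 → ℝ) (x : R2) : ℝ :=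
  ∑ i : Fin 2, (φ (x + ε • axis i) + φ (x - ε • axis i) - 2 * φ x)

lemma abs_discreteLap_sub_le {φ : R2 → ℝ} (hφ : ContDiff ℝ 2 φ) {ε δ : ℝ} (hε : 0 ≤ ε)
    (hδ : ∀ i x y, dist x y ≤ ε →
      ‖partialDeriv i (partialDeriv i φ) x - partialDeriv i (partialDeriv i φ) y‖ ≤ δ)
    (x : R2) : |discreteLap ε φ x - ε ^ 2 * lap φ x| ≤ 2 * δ * ε ^ 2 := by
  rw [lap_eq_sum_partialDeriv hφ.contDiffAt, discreteLap, Finset.mul_sum,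
    ← Finset.sum_sub_distrib]
  have hd1 : Differentiable ℝ φ := hφ.differentiable (by simp)
  have hi : ∀ i : Fin 2, |φ (x + ε • axis i) + φ (x - ε • axis i) - 2 * φ x -
      ε ^ 2 * partialDeriv i (partialDeriv i φ) x| ≤ δ * ε ^ 2 := by
    intro i
    have hd2 : Differentiable ℝ (partialDeriv i φ) :=
      (hφ.partialDeriv (m := 1) (by norm_num) i).differentiable (by simp)
    have hclose : ∀ t : ℝ, |t| ≤ ε →
        |partialDeriv i (partialDeriv i φ) (x + t • axis i) -
          partialDeriv i (partialDeriv i φ) x| ≤ δ := fun t ht =>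
      hδ i (x + t • axis i) x (by simpa [norm_smul] using ht)
    have hup := second_difference_le (g := fun t : ℝ => φ (x + t • axis i))
      (M := partialDeriv i (partialDeriv i φ) x + δ) hε
      (fun t => hasDerivAt_line _ (hd1 _)) (fun t => hasDerivAt_line _ (hd2 _))
      (fun t ht => by have := (abs_le.1 (hclose t ht)).2; unfold partialDeriv at *; linarith)
    have hlo := second_difference_le (g := fun t : ℝ => -φ (x + t • axis i))
      (M := -partialDeriv i (partialDeriv i φ) x + δ) hε
      (fun t => (hasDerivAt_line _ (hd1 _)).neg) (fun t => (hasDerivAt_line _ (hd2 _)).neg)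
      (fun t ht => by have := (abs_le.1 (hclose t ht)).1; unfold partialDeriv at *; linarith)
    simp only [neg_smul, ← sub_eq_add_neg, zero_smul, add_zero] at hup hlo
    rw [abs_le]
    constructor <;> linarith
  refine (Finset.abs_sum_le_sum_abs _ _).trans ?_
  rw [Fin.sum_univ_two]
  linarith [hi 0, hi 1]

lemma tendstoUniformly_discreteLap {φ : R2 → ℝ} (hφ : ContDiff ℝ 2 φ) (hs : HasCompactSupport φ)
    {ι : Type*} {l : Filter ι} {ε : ι → ℝ} (hε : ∀ n, 0 < ε n) (hlim : Tendsto ε l (nhds 0)) :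
    TendstoUniformly (fun n x => (ε n ^ 2)⁻¹ * discreteLap (ε n) φ x) (lap φ) l := by
  rw [Metric.tendstoUniformly_iff]
  intro δ hδ
  have hmod : ∀ i : Fin 2, ∃ η > 0, ∀ x y : R2, dist x y < η →
      ‖partialDeriv i (partialDeriv i φ) x - partialDeriv i (partialDeriv i φ) y‖ < δ / 4 :=
    fun i => exists_modulus ((hs.partialDeriv i).partialDeriv i)
      ((hφ.partialDeriv (m := 1) (by norm_num) i).partialDeriv (m := 0) (by norm_num) i).continuous
      (by positivity)
  choose η hη hη' using hmod
  filter_upwards [hlim.eventually (gt_mem_nhds (hη 0)),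
    hlim.eventually (gt_mem_nhds (hη 1))] with n hn0 hn1 x
  have h1 := abs_discreteLap_sub_le hφ (hε n).le (δ := δ / 4)
    (fun i x y hxy => (hη' i x y (hxy.trans_lt (by fin_cases i <;> assumption))).le) x
  have h0 : ε n ≠ 0 := (hε n).ne'
  have h3 : (ε n ^ 2)⁻¹ * discreteLap (ε n) φ x - lap φ x =
      (ε n ^ 2)⁻¹ * (discreteLap (ε n) φ x - ε n ^ 2 * lap φ x) := by
    field_simp
  rw [dist_comm, Real.dist_eq, h3, abs_mul, abs_of_nonneg (by positivity : 0 ≤ (ε n ^ 2)⁻¹)]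
  calc (ε n ^ 2)⁻¹ * |discreteLap (ε n) φ x - ε n ^ 2 * lap φ x|
      ≤ (ε n ^ 2)⁻¹ * (2 * (δ / 4) * ε n ^ 2) := by gcongr
    _ = δ / 2 := by field_simp; ring
    _ < δ := by linarith

lemma tendsto_integral_of_tendstoUniformly {ι : Type*} {l : Filter ι} {w : ι → R2 → ℝ}
    {w₀ : R2 → ℝ} {K : Set R2} (hK : IsCompact K) (hw : ∀ n, Integrable (w n))
    (hw₀ : Integrable w₀) (hwK : ∀ n x, x ∉ K → w n x = 0) (hw₀K : ∀ x, x ∉ K → w₀ x = 0)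
    (h : TendstoUniformly w w₀ l) :
    Tendsto (fun n => ∫ x, w n x) l (nhds (∫ x, w₀ x)) := by
  rw [Metric.tendsto_nhds]
  intro δ hδ
  set V := volume.real K with hV
  have hV0 : 0 ≤ V := measureReal_nonneg
  filter_upwards [Metric.tendstoUniformly_iff.1 h (δ / (V + 1)) (by positivity)] with n hn
  rw [dist_eq_norm, ← integral_sub (hw n) hw₀,
    ← setIntegral_eq_integral_of_forall_compl_eq_zero (s := K)
      (fun x hx => by rw [hwK n x hx, hw₀K x hx, sub_zero])]
  have := norm_setIntegral_le_of_norm_le_const (μ := volume) (s := K) (C := δ / (V + 1))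
    (f := fun x => w n x - w₀ x) hK.measure_lt_top
    (fun x _ => by rw [← dist_eq_norm, dist_comm]; exact (hn x).le)
  refine this.trans_lt ?_
  rw [← hV, div_mul_eq_mul_div, div_lt_iff₀ (by positivity)]
  nlinarith

lemma tendstoUniformly_mul_of_bounded {ι : Type*} {l : Filter ι} {v w : ι → R2 → ℝ}
    {v₀ w₀ : R2 → ℝ} {K K' : ℝ} (hK : ∀ n x, |v n x| ≤ K) (hK' : ∀ x, |w₀ x| ≤ K')
    (hv : TendstoUniformly v v₀ l) (hw : TendstoUniformly w w₀ l) :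
    TendstoUniformly (fun n x => v n x * w n x) (fun x => v₀ x * w₀ x) l := by
  rw [Metric.tendstoUniformly_iff] at *
  intro δ hδ
  filter_upwards [hv (δ / (2 * (|K'| + 1))) (by positivity),
    hw (δ / (2 * (|K| + 1))) (by positivity)] with n h1 h2 x
  have e1 := h1 x
  have e2 := h2 x
  rw [Real.dist_eq, lt_div_iff₀ (by positivity)] at e1 e2
  rw [Real.dist_eq]
  have e3 : v₀ x * w₀ x - v n x * w n x =
    (v₀ x - v n x) * w₀ x + v n x * (w₀ x - w n x) := by ring
  rw [e3]
  refine (abs_add_le _ _).trans_lt ?_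
  rw [abs_mul, abs_mul]
  have k1 := (hK n x).trans (le_abs_self K)
  have k2 := (hK' x).trans (le_abs_self K')
  nlinarith [abs_nonneg (v₀ x - v n x), abs_nonneg (w₀ x - w n x)]

lemma Integrable.bounded_mul_of_hasCompactSupport {u φ : R2 → ℝ} (hu : Measurable u) {K : ℝ}
    (hK : ∀ x, |u x| ≤ K) (hφ : Continuous φ) (hs : HasCompactSupport φ) :
    Integrable fun x => u x * φ x :=
  (hφ.integrable_of_hasCompactSupport hs).bdd_mul hu.aestronglyMeasurable
    (Eventually.of_forall hK)

/-- Summation by parts in the discrete equation. -/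
lemma IsDiscreteSol.integral_mul_discreteLap {Ω : Set R2} {ε μ : ℝ} {u : R2 → ℝ}
    (hu : IsDiscreteSol Ω ε μ u) {φ : R2 → ℝ} (hφ : Continuous φ) (hs : HasCompactSupport φ)
    (hsΩ : tsupport φ ⊆ Ω) :
    ∫ x, u x * discreteLap ε φ x = -(ε ^ 2) * ∫ x, μ * exp (u x) * φ x := by
  have hK : ∀ x, |u x| ≤ 1 / 2 := fun x => by
    rw [abs_of_nonneg (hu.nonneg x)]; exact hu.le_half x
  have hintg : ∀ v w : R2, Integrable fun x => u (x + v) * φ (x + w) := fun v w =>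
    Integrable.bounded_mul_of_hasCompactSupport (hu.measurable.comp (measurable_add_const v))
      (fun x => hK _) (hφ.comp (continuous_add_const w))
      (hs.comp_homeomorph (Homeomorph.addRight w))
  have hI : ∀ w : R2, Integrable fun x => u x * φ (x + w) := fun w => by
    simpa using hintg 0 w
  have hJ : ∀ v : R2, Integrable fun x => u (x + v) * φ x := fun v => by
    simpa using hintg v 0
  have hshift : ∀ v : R2, ∫ x, u x * φ (x + v) = ∫ x, u (x + -v) * φ x := fun v => by
    rw [← integral_add_right_eq_self (fun x => u (x + -v) * φ x) v]
    simp
  have h0 : Integrable fun x => u x * φ x := by simpa using hintg 0 0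
  have hI' : ∀ i : Fin 2, Integrable fun x => u x * φ (x + ε • axis i) +
      u x * φ (x + -(ε • axis i)) := fun i => (hI _).add (hI _)
  have hJ' : ∀ i : Fin 2, Integrable fun x => u (x + -(ε • axis i)) * φ x +
      u (x + ε • axis i) * φ x := fun i => (hJ _).add (hJ _)
  calc ∫ x, u x * discreteLap ε φ x
      = ∑ i : Fin 2, ((∫ x, u x * φ (x + ε • axis i)) + (∫ x, u x * φ (x + -(ε • axis i))) -
          2 * ∫ x, u x * φ x) := by
        have : ∀ x, u x * discreteLap ε φ x = ∑ i : Fin 2, (u x * φ (x + ε • axis i) +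
            u x * φ (x + -(ε • axis i)) - 2 * (u x * φ x)) := by
          intro x; simp only [discreteLap, Finset.mul_sum, ← sub_eq_add_neg]
          refine Finset.sum_congr rfl fun i _ => by ring
        simp only [this]
        rw [integral_finsetSum]
        swap
        · exact fun i _ => (hI' i).sub (h0.const_mul 2)
        refine Finset.sum_congr rfl fun i _ => ?_
        rw [integral_sub (hI' i) (h0.const_mul 2), integral_add (hI _) (hI _),
          integral_const_mul]
    _ = ∑ i : Fin 2, ∫ x, (u (x + -(ε • axis i)) * φ x + u (x + ε • axis i) * φ x -
          2 * (u x * φ x)) := by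
        refine Finset.sum_congr rfl fun i _ => ?_
        rw [integral_sub (hJ' i) (h0.const_mul 2), integral_add (hJ _) (hJ _),
          integral_const_mul, hshift, hshift, neg_neg]
    _ = ∫ x, -(ε ^ 2) * (μ * exp (u x) * φ x) := by
        rw [← integral_finsetSum]
        swap
        · exact fun i _ => (hJ' i).sub (h0.const_mul 2)
        refine integral_congr_ae (Eventually.of_forall fun x => ?_)
        by_cases hx : x ∈ Ω
        · have h1 := hu.eq x hx
          simp only [axisAvg, Fin.sum_univ_two, ← sub_eq_add_neg] at h1 ⊢
          linear_combination (-4 * φ x) * h1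
        · have : φ x = 0 := image_eq_zero_of_notMem_tsupport fun h => hx (hsΩ h)
          simp [this]
    _ = _ := integral_const_mul _ _

lemma exists_ultralimit {f : ℕ → ℝ} (hf : ∀ n, f n ∈ Icc (0 : ℝ) (1 / 2)) :
    ∃ l ∈ Icc (0 : ℝ) (1 / 2), Tendsto f (hyperfilter ℕ) (nhds l) := by
  obtain ⟨l, hl, hle⟩ := isCompact_Icc.ultrafilter_le_nhds ((hyperfilter ℕ).map f)
    (le_principal_iff.2 (Filter.mem_map.2 (Eventually.of_forall hf)))
  exact ⟨l, hl, hle⟩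

lemma tendstoUniformly_of_almost_lipschitz {ι : Type*} {l : Filter ι} {Ω : Set R2}
    (hb : Bornology.IsBounded Ω) {v : ι → R2 → ℝ} {w : R2 → ℝ} {ε : ι → ℝ}
    (hε : Tendsto ε l (nhds 0)) {C : ℝ} (hC : 0 ≤ C)
    (hv : ∀ n x y, |v n x - v n y| ≤ C * (‖x - y‖ + ε n))
    (hw : ∀ x y, |w x - w y| ≤ C * ‖x - y‖) (hv0 : ∀ n x, x ∉ Ω → v n x = 0)
    (hw0 : ∀ x, x ∉ Ω → w x = 0) (h : ∀ x, Tendsto (fun n => v n x) l (nhds (w x))) :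
    TendstoUniformly v w l := by
  rw [Metric.tendstoUniformly_iff]
  intro δ hδ
  obtain ⟨t, ht, hcov⟩ := Metric.totallyBounded_iff.1 
    (hb.isCompact_closure.totallyBounded.subset subset_closure) (δ / (6 * (C + 1)))
    (by positivity)
  have h1 : ∀ᶠ n in l, ∀ y ∈ t, dist (v n y) (w y) < δ / 3 :=
    (ht.eventually_all).2 fun y _ => Metric.tendsto_nhds.1 (h y) _ (by positivity)
  have h2 : ∀ᶠ n in l, C * ε n < δ / 3 := by
    have : Tendsto (fun n => C * ε n) l (nhds (C * 0)) := hε.const_mul C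
    rw [mul_zero] at this
    exact this.eventually (gt_mem_nhds (by positivity))
  filter_upwards [h1, h2] with n hn1 hn2 x
  by_cases hx : x ∈ Ω
  · obtain ⟨y, hy, hxy⟩ := mem_iUnion₂.1 (hcov hx)
    rw [Metric.mem_ball, dist_eq_norm, lt_div_iff₀ (by positivity)] at hxy
    have e1 := hn1 y hy
    have e2 := hv n x y
    have e3 := hw x y
    rw [Real.dist_eq] at e1 ⊢
    have e4 := abs_le.1 e2
    have e5 := abs_le.1 e3
    have e6 := abs_lt.1 e1
    have e7 := norm_nonneg (x - y)
    rw [abs_lt]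
    constructor <;> nlinarith
  · rw [hv0 n x hx, hw0 x hx, dist_self]; exact hδ

lemma exists_weak_solution_family {Ω : Set R2} (hΩ : IsOpen Ω) (hb : Bornology.IsBounded Ω)
    (hc : Convex ℝ Ω) {ν : R2} (hν : ‖ν‖ = 1) {a b μ₁ : ℝ}
    (hO : ∀ x ∈ Ω, a ≤ inner ℝ ν x ∧ inner ℝ ν x ≤ b) (hμ₁ : 0 ≤ μ₁)
    (hB : μ₁ * exp (1 / 2) * (b - a) ^ 2 / 8 < 1 / 2) :
    ∃ (u : ℝ → R2 → ℝ) (C C' : ℝ), 0 ≤ C ∧ ∀ μ ∈ Icc 0 μ₁,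
      (∀ x, u μ x ∈ Icc (0 : ℝ) (1 / 2)) ∧ (∀ x, x ∉ Ω → u μ x = 0) ∧
      (∀ x y, |u μ x - u μ y| ≤ C * ‖x - y‖) ∧
      (∀ μ' ∈ Icc 0 μ₁, ∀ x, |u μ x - u μ' x| ≤ C' * |μ - μ'|) ∧
      ∀ φ : R2 → ℝ, ContDiff ℝ 2 φ → HasCompactSupport φ → tsupport φ ⊆ Ω →
        ∫ x, u μ x * lap φ x = -∫ x, μ * exp (u μ x) * φ x := by
  obtain ⟨R, hR0, hR⟩ : ∃ R : ℝ, 0 ≤ R ∧ ∀ x ∈ Ω, ‖x‖ ≤ R := by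
    obtain ⟨R, hR⟩ := hb.exists_norm_le
    exact ⟨max R 0, le_max_right _ _, fun x hx => (hR x hx).trans (le_max_left _ _)⟩
  obtain ⟨ε₀, hε₀, hε₁, hBε⟩ : ∃ ε₀ : ℝ, 0 < ε₀ ∧ ε₀ ≤ 1 ∧ ∀ ε, 0 ≤ ε → ε ≤ ε₀ →
      μ₁ * exp (1 / 2) * (b - a + 2 * ε) ^ 2 / 8 ≤ 1 / 2 := by
    have hcont : Continuous fun ε : ℝ => μ₁ * exp (1 / 2) * (b - a + 2 * ε) ^ 2 / 8 := by fun_prop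
    have h1 := hcont.tendsto 0
    rw [mul_zero, add_zero] at h1
    obtain ⟨r, hr, hr'⟩ := Metric.eventually_nhds_iff.1 (h1.eventually (gt_mem_nhds hB))
    refine ⟨min (r / 2) 1, by positivity, min_le_right _ _, fun ε h0 h => (hr' ?_).le⟩
    rw [dist_zero_right, norm_of_nonneg h0]
    linarith [min_le_left (r / 2) 1]
  set ε : ℕ → ℝ := fun n => ε₀ * (1 / ((n : ℝ) + 1)) with hεdef
  have hεpos : ∀ n, 0 < ε n := fun n => by positivity
  have hεle : ∀ n, ε n ≤ ε₀ := fun n => by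
    have : 1 / ((n : ℝ) + 1) ≤ 1 := by
      rw [div_le_one (by positivity)]; linarith [n.cast_nonneg (α := ℝ)]
    simp only [hεdef]
    nlinarith
  have hlimε : Tendsto ε (hyperfilter ℕ) (nhds 0) := by
    have h1 : Tendsto ε atTop (nhds (ε₀ * 0)) :=
      tendsto_one_div_add_atTop_nhds_zero_nat.const_mul ε₀
    rw [mul_zero] at h1
    exact h1.mono_left Nat.hyperfilter_le_atTop
  have hBn : ∀ n, μ₁ * exp (1 / 2) * (b - a + 2 * ε n) ^ 2 / 8 ≤ 1 / 2 := fun n =>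
    hBε _ (hεpos n).le (hεle n)
  have hex : ∀ n μ, ∃ u, μ ∈ Icc 0 μ₁ → IsDiscreteSol Ω (ε n) μ u := by
    intro n μ
    by_cases hμ : μ ∈ Icc 0 μ₁
    · have hBμ : μ * exp (1 / 2) * (b - a + 2 * ε n) ^ 2 / 8 ≤ 1 / 2 := by
        refine le_trans ?_ (hBn n)
        have := hμ.2
        gcongr
      obtain ⟨u, hu⟩ := exists_isDiscreteSol hΩ.measurableSet hν (hεpos n) hO hμ.1 hBμ
      exact ⟨u, fun _ => hu⟩
    · exact ⟨0, fun h => absurd h hμ⟩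
  choose U hU using hex
  have hlim : ∀ μ x, ∃ l, μ ∈ Icc 0 μ₁ → l ∈ Icc (0 : ℝ) (1 / 2) ∧
      Tendsto (fun n => U n μ x) (hyperfilter ℕ) (nhds l) := by
    intro μ x
    by_cases hμ : μ ∈ Icc 0 μ₁
    · obtain ⟨l, hl, hl'⟩ := exists_ultralimit (f := fun n => U n μ x)
        (fun n => ⟨(hU n μ hμ).nonneg x, (hU n μ hμ).le_half x⟩)
      exact ⟨l, fun _ => ⟨hl, hl'⟩⟩
    · exact ⟨0, fun h => absurd h hμ⟩
  choose u hu using hlim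
  set C := μ₁ * exp (1 / 2) * (2 * R + 1) with hC
  have hC0 : 0 ≤ C := by positivity
  refine ⟨u, C, exp (1 / 2) * (b - a) ^ 2 / 4, hC0, fun μ hμ => ?_⟩
  have hUlip : ∀ n x y, |U n μ x - U n μ y| ≤ C * (‖x - y‖ + ε n) := fun n x y =>
    (hU n μ hμ).abs_sub_le hΩ hc hR hR0 hν (hεpos n) ((hεle n).trans hε₁) hO hμ.1 hμ.2 (hBn n) x y
  have hmem : ∀ x, u μ x ∈ Icc (0 : ℝ) (1 / 2) := fun x => (hu μ x hμ).1
  have hzero : ∀ x, x ∉ Ω → u μ x = 0 := by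
    intro x hx
    have h1 := (hu μ x hμ).2
    simp only [(hU _ μ hμ).zero x hx] at h1
    exact tendsto_nhds_unique h1 tendsto_const_nhds
  have hlip : ∀ x y, |u μ x - u μ y| ≤ C * ‖x - y‖ := by
    intro x y
    refine le_of_tendsto_of_tendsto' (((hu μ x hμ).2.sub (hu μ y hμ).2).abs) ?_
      (fun n => hUlip n x y)
    simpa using (hlimε.const_add ‖x - y‖).const_mul C
  refine ⟨hmem, hzero, hlip, fun μ' hμ' x => ?_, fun φ hφ hs hsΩ => ?_⟩
  · have h1 : Tendsto (fun n => |μ - μ'| * exp (1 / 2) * (b - a + 2 * ε n) ^ 2 / 4)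
        (hyperfilter ℕ) (nhds (|μ - μ'| * exp (1 / 2) * (b - a + 2 * 0) ^ 2 / 4)) :=
      ((((hlimε.const_mul 2).const_add (b - a)).pow 2).const_mul _).div_const 4
    refine (le_of_tendsto_of_tendsto' (((hu μ x hμ).2.sub (hu μ' x hμ').2).abs) h1
      (fun n => (hU n μ hμ).abs_sub_le_of_param (hU n μ' hμ') hν (hεpos n) hO hμ.1 hμ.2
        (hBn n) x)).trans (le_of_eq ?_)
    ring
  · have hunif : TendstoUniformly (fun n => U n μ) (u μ) (hyperfilter ℕ) :=
      tendstoUniformly_of_almost_lipschitz hb hlimε hC0 hUlip hlip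
        (fun n x hx => (hU n μ hμ).zero x hx) hzero (fun x => (hu μ x hμ).2)
    have hucont : Continuous (u μ) := by
      refine (LipschitzWith.of_dist_le_mul (K := ⟨C, hC0⟩) fun x y => ?_).continuous
      rw [Real.dist_eq, dist_eq_norm]; exact hlip x y
    have hK : IsCompact (Metric.cthickening 1 (tsupport φ)) := hs.isCompact.cthickening
    have hφ0 : ∀ x, x ∉ Metric.cthickening 1 (tsupport φ) → φ x = 0 := fun x hx =>
      image_eq_zero_of_notMem_tsupport fun h => hx (Metric.self_subset_cthickening _ h)
    have hlap : lap φ = fun x => ∑ i : Fin 2, partialDeriv i (partialDeriv i φ) x :=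
      funext fun x => lap_eq_sum_partialDeriv hφ.contDiffAt
    have hpd : ∀ i, Continuous (partialDeriv i (partialDeriv i φ)) := fun i =>
      ((hφ.partialDeriv (m := 1) (by norm_num) i).partialDeriv (m := 0) (by norm_num) i).continuous
    have hlapc : Continuous (lap φ) := by
      rw [hlap]; exact continuous_finsetSum _ fun i _ => hpd i
    have hlap0 : ∀ x, x ∉ Metric.cthickening 1 (tsupport φ) → lap φ x = 0 := by
      intro x hx
      have hx' : x ∉ tsupport φ := fun h => hx (Metric.self_subset_cthickening _ h)
      rw [hlap]
      refine Finset.sum_eq_zero fun i _ => image_eq_zero_of_notMem_tsupport fun h => hx' ?_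
      exact (tsupport_fderiv_apply_subset ℝ _).trans (tsupport_fderiv_apply_subset ℝ _) h
    have hlaps : HasCompactSupport (lap φ) := HasCompactSupport.intro hK hlap0
    have hdl0 : ∀ n x, x ∉ Metric.cthickening 1 (tsupport φ) → discreteLap (ε n) φ x = 0 := by
      intro n x hx
      have hε1 : ε n ≤ 1 := (hεle n).trans hε₁
      have hv : ∀ v : R2, ‖v‖ ≤ 1 → φ (x + v) = 0 := fun v hv =>
        image_eq_zero_of_notMem_tsupport fun h => hx
          (Metric.mem_cthickening_of_dist_le x (x + v) 1 _ h (by simpa using hv))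
      have hnorm : ∀ i : Fin 2, ‖ε n • axis i‖ ≤ 1 := fun i => by
        rw [norm_smul, Real.norm_of_nonneg (hεpos n).le]; simpa using hε1
      refine Finset.sum_eq_zero fun i _ => ?_
      rw [sub_eq_add_neg x, hv _ (hnorm i), hv _ (by rw [norm_neg]; exact hnorm i), hφ0 x hx]
      ring
    have hdlc : ∀ n, Continuous fun x => (ε n ^ 2)⁻¹ * discreteLap (ε n) φ x := fun n => by
      have := hφ.continuous
      unfold discreteLap
      fun_prop
    have hdls : ∀ n, HasCompactSupport fun x => (ε n ^ 2)⁻¹ * discreteLap (ε n) φ x := fun n =>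
      HasCompactSupport.intro hK fun x hx => by rw [hdl0 n x hx, mul_zero]
    have hUb : ∀ n x, |U n μ x| ≤ 1 / 2 := fun n x => by
      rw [abs_of_nonneg ((hU n μ hμ).nonneg x)]; exact (hU n μ hμ).le_half x
    have hub : ∀ x, |u μ x| ≤ 1 / 2 := fun x => by
      rw [abs_of_nonneg (hmem x).1]; exact (hmem x).2
    obtain ⟨Kφ, hKφ⟩ := hs.exists_bound_of_continuous hφ.continuous
    obtain ⟨Kl, hKl⟩ := hlaps.exists_bound_of_continuous hlapc
    have hlim1 := tendsto_integral_of_tendstoUniformly hK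
      (fun n => Integrable.bounded_mul_of_hasCompactSupport (hU n μ hμ).measurable (hUb n)
        (hdlc n) (hdls n))
      (Integrable.bounded_mul_of_hasCompactSupport hucont.measurable hub hlapc hlaps)
      (fun n x hx => by rw [hdl0 n x hx, mul_zero, mul_zero])
      (fun x hx => by rw [hlap0 x hx, mul_zero])
      (tendstoUniformly_mul_of_bounded hUb hKl hunif
        (tendstoUniformly_discreteLap hφ hs hεpos hlimε))
    have hexpb : ∀ t, |t| ≤ 1 / 2 → |μ * exp t| ≤ μ * exp (1 / 2) := fun t ht => by
      rw [abs_of_nonneg (mul_nonneg hμ.1 (exp_pos _).le)]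
      exact mul_le_mul_of_nonneg_left (exp_le_exp.2 (abs_le.1 ht).2) hμ.1
    have hexpu : TendstoUniformly (fun n x => μ * exp (U n μ x)) (fun x => μ * exp (u μ x))
        (hyperfilter ℕ) := by
      rw [Metric.tendstoUniformly_iff] at hunif ⊢
      intro δ hδ
      filter_upwards [hunif (δ / (μ * exp (1 / 2) + 1)) (by have := hμ.1; positivity)] with n hn x
      have e1 := hn x
      have := hμ.1
      rw [Real.dist_eq, lt_div_iff₀ (by positivity)] at e1
      rw [Real.dist_eq, ← mul_sub, abs_mul, abs_of_nonneg hμ.1]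
      have e2 := abs_exp_sub_exp_le (abs_le.1 (hub x)).2 (abs_le.1 (hUb n x)).2
      have e3 := mul_le_mul_of_nonneg_left e2 hμ.1
      nlinarith [abs_nonneg (u μ x - U n μ x)]
    have hlim2 := tendsto_integral_of_tendstoUniformly hK
      (fun n => Integrable.bounded_mul_of_hasCompactSupport
        ((measurable_exp.comp (hU n μ hμ).measurable).const_mul μ)
        (fun x => hexpb _ (hUb n x)) hφ.continuous hs)
      (Integrable.bounded_mul_of_hasCompactSupport
        ((measurable_exp.comp hucont.measurable).const_mul μ)
        (fun x => hexpb _ (hub x)) hφ.continuous hs)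
      (fun n x hx => by rw [hφ0 x hx, mul_zero])
      (fun x hx => by rw [hφ0 x hx, mul_zero])
      (tendstoUniformly_mul_of_bounded (fun n x => hexpb _ (hUb n x)) hKφ hexpu
        (fun _ h => Eventually.of_forall fun _ _ => refl_mem_uniformity h))
    refine tendsto_nhds_unique hlim1 (hlim2.neg.congr fun n => ?_)
    have h0 : ε n ≠ 0 := (hεpos n).ne'
    have h1 := (hU n μ hμ).integral_mul_discreteLap hφ.continuous hs hsΩ
    simp only [mul_left_comm _ (ε n ^ 2)⁻¹, integral_const_mul, h1, Function.comp_apply]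
    field_simp

lemma lap_radial {k k' k'' : ℝ → ℝ} (h1 : ∀ s, HasDerivAt k (k' s) s)
    (h2 : ∀ s, HasDerivAt k' (k'' s) s) (x : R2) :
    lap (fun x => k (‖x‖ ^ 2)) x = 4 * (k' (‖x‖ ^ 2) + ‖x‖ ^ 2 * k'' (‖x‖ ^ 2)) := by
  have hline : ∀ (i : Fin 2) (t : ℝ), ‖x + t • axis i‖ ^ 2 = ‖x‖ ^ 2 + 2 * t * x i + t ^ 2 := by
    intro i t
    rw [norm_add_sq_real, norm_smul, inner_smul_right, EuclideanSpace.inner_single_right]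
    simp
    ring
  have hs : ∀ (i : Fin 2) (t : ℝ), HasDerivAt (fun t : ℝ => ‖x‖ ^ 2 + 2 * t * x i + t ^ 2)
      (2 * x i + 2 * t) t := by
    intro i t
    have := ((((hasDerivAt_id t).const_mul 2).mul_const (x i)).const_add (‖x‖ ^ 2)).add
      (hasDerivAt_pow 2 t)
    refine this.congr_deriv ?_
    simp
  have hd : ∀ i : Fin 2, iteratedDeriv 2 (fun t : ℝ => k (‖x + t • axis i‖ ^ 2)) 0 =
      4 * x i ^ 2 * k'' (‖x‖ ^ 2) + 2 * k' (‖x‖ ^ 2) := by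
    intro i
    simp only [hline]
    rw [iteratedDeriv_succ, iteratedDeriv_one]
    have e1 : deriv (fun t : ℝ => k (‖x‖ ^ 2 + 2 * t * x i + t ^ 2)) =
        fun t => k' (‖x‖ ^ 2 + 2 * t * x i + t ^ 2) * (2 * x i + 2 * t) :=
      funext fun t => ((h1 _).comp t (hs i t)).deriv
    rw [e1]
    have e2 : HasDerivAt (fun t : ℝ => 2 * x i + 2 * t) 2 0 := by
      simpa using ((hasDerivAt_id (0 : ℝ)).const_mul 2).const_add (2 * x i)
    have e3 := (((h2 _).comp (0 : ℝ) (hs i 0)).mul e2).deriv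
    refine e3.trans ?_
    simp
    ring
  unfold lap
  rw [Finset.sum_congr rfl fun i _ => hd i, EuclideanSpace.norm_sq_eq, Fin.sum_univ_two,
    Fin.sum_univ_two]
  simp only [Real.norm_eq_abs, sq_abs]
  ring

lemma exists_smooth_neg_log : ∃ g : ℝ → ℝ, ContDiff ℝ 4 g ∧ ∀ s, 1 / 2 ≤ s → g s = -log s := by
  refine ⟨fun s => -log (s * smoothTransition (4 * s - 1) + (1 - smoothTransition (4 * s - 1))),
    ?_, fun s hs => ?_⟩
  · have hT : ContDiff ℝ 4 fun s : ℝ => smoothTransition (4 * s - 1) :=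
      (smoothTransition.contDiff (n := 4)).comp
        ((contDiff_const.mul contDiff_id).sub contDiff_const)
    refine (ContDiff.log ((contDiff_id.mul hT).add (contDiff_const.sub hT)) fun s => ?_).neg
    have h0 := smoothTransition.nonneg (4 * s - 1)
    have h1 := smoothTransition.le_one (4 * s - 1)
    rcases le_or_gt s (1 / 4) with h | h
    · rw [smoothTransition.zero_of_nonpos (by linarith)]; simp
    · refine ne_of_gt ?_
      simp only [id]
      nlinarith
  · simp only
    rw [smoothTransition.one_of_one_le (by linarith)]
    simp

lemma hasCompactSupport_of_eq_zero {K : R2 → ℝ} (h : ∀ x, 1 < ‖x‖ → K x = 0) :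
    HasCompactSupport K :=
  HasCompactSupport.intro (isCompact_closedBall 0 1) fun x hx => h x (by
    rwa [Metric.mem_closedBall, dist_zero_right, not_le] at hx)

/-- Dyadic pieces of the fundamental solution: `κ` is the difference of two consecutive smooth
truncations of the logarithm, and `χ` is the corresponding mollifier. -/
lemma exists_dyadic_kernel : ∃ κ χ : R2 → ℝ, ContDiff ℝ 2 κ ∧ ContDiff ℝ 2 χ ∧
    (∀ x, 1 < ‖x‖ → κ x = 0) ∧ (∀ x, 1 < ‖x‖ → χ x = 0) ∧
    (∀ x, lap κ x = χ x - 4 * χ ((2 : ℝ) • x)) ∧ ∫ x, χ x ≠ 0 := by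
  obtain ⟨g, hg, hlog⟩ := exists_smooth_neg_log
  have hg1 : ContDiff ℝ 3 (deriv g) := ContDiff.deriv' (n := 3) (by exact_mod_cast hg)
  have hg2 : ContDiff ℝ 2 (deriv (deriv g)) := ContDiff.deriv' (n := 2) (by exact_mod_cast hg1)
  have hd1 : ∀ s, HasDerivAt g (deriv g s) s := fun s =>
    (hg.differentiable (by simp) s).hasDerivAt
  have hd2 : ∀ s, HasDerivAt (deriv g) (deriv (deriv g) s) s := fun s =>
    (hg1.differentiable (by simp) s).hasDerivAt
  have hdlog : ∀ s, 1 / 2 < s → deriv g s = -s⁻¹ := fun s hs => by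
    have : g =ᶠ[nhds s] fun s => -log s :=
      (lt_mem_nhds hs).mono fun y hy => hlog y hy.le
    rw [this.deriv_eq]
    exact (hasDerivAt_log (by linarith)).neg.deriv
  have hddlog : ∀ s, 1 / 2 < s → deriv (deriv g) s = (s ^ 2)⁻¹ := fun s hs => by
    have : deriv g =ᶠ[nhds s] fun s => -s⁻¹ :=
      (lt_mem_nhds hs).mono fun y hy => hdlog y hy
    rw [this.deriv_eq]
    simp
  set ψ : ℝ → ℝ := fun s => -4 * (deriv g s + s * deriv (deriv g) s) with hψ
  have hψc : ContDiff ℝ 2 ψ := by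
    have := hg1.of_le (m := 2) (by norm_num)
    exact contDiff_const.mul (this.add (contDiff_id.mul hg2))
  have hψ0 : ∀ s, 1 ≤ s → ψ s = 0 := fun s hs => by
    rw [hψ]
    simp only
    rw [hdlog s (by linarith), hddlog s (by linarith)]
    field_simp
    ring
  have hn : ContDiff ℝ 2 fun x : R2 => ‖x‖ ^ 2 := contDiff_norm_sq ℝ
  have hsq : ∀ x : R2, 1 < ‖x‖ → 1 ≤ ‖x‖ ^ 2 := fun x hx => one_le_pow₀ hx.le
  have hχ0 : ∀ x : R2, 1 < ‖x‖ → ψ (‖x‖ ^ 2) = 0 := fun x hx => hψ0 _ (hsq x hx)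
  have hχc : ContDiff ℝ 2 fun x : R2 => ψ (‖x‖ ^ 2) := hψc.comp hn
  refine ⟨fun x => (fun s => g (4 * s) + log 4 - g s) (‖x‖ ^ 2), fun x => ψ (‖x‖ ^ 2),
    ?_, hχc, fun x hx => ?_, hχ0, fun x => ?_, ?_⟩
  · have hg' : ContDiff ℝ 2 g := hg.of_le (by norm_num)
    exact ((hg'.comp (contDiff_const.mul hn)).add contDiff_const).sub (hg'.comp hn)
  · have := hsq x hx
    simp only
    rw [hlog _ (by linarith), hlog _ (by linarith), log_mul (by norm_num) (by linarith)]
    ring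
  · have hm : ∀ s : ℝ, HasDerivAt (fun s : ℝ => 4 * s) 4 s := fun s => by
      simpa using (hasDerivAt_id s).const_mul 4
    have h1 : ∀ s, HasDerivAt (fun s => g (4 * s) + log 4 - g s)
        (deriv g (4 * s) * 4 - deriv g s) s := fun s =>
      (((hd1 _).comp s (hm s)).add_const _).sub (hd1 s)
    have h2 : ∀ s, HasDerivAt (fun s => deriv g (4 * s) * 4 - deriv g s)
        (deriv (deriv g) (4 * s) * 4 * 4 - deriv (deriv g) s) s := fun s =>
      (((hd2 _).comp s (hm s)).mul_const _).sub (hd2 s)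
    rw [lap_radial h1 h2 x]
    have h3 : ‖(2 : ℝ) • x‖ ^ 2 = 4 * ‖x‖ ^ 2 := by rw [norm_smul, mul_pow]; norm_num
    simp only [hψ, h3]
    ring
  · rw [integral_fun_norm_addHaar volume fun y => ψ (y ^ 2)]
    have hder : ∀ y : ℝ, HasDerivAt (fun y : ℝ => -2 * y ^ 2 * deriv g (y ^ 2))
        (y ^ (Module.finrank ℝ R2 - 1) • ψ (y ^ 2)) y := by
      intro y
      have h1 := ((hasDerivAt_pow 2 y).const_mul (-2)).mul ((hd2 (y ^ 2)).comp y (hasDerivAt_pow 2 y))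
      refine h1.congr_deriv ?_
      simp [hψ]
      ring
    have hintg : IntegrableOn (fun y : ℝ => y ^ (Module.finrank ℝ R2 - 1) • ψ (y ^ 2)) (Ioi 0) := by
      refine Continuous.integrable_of_hasCompactSupport ?_ ?_ |>.integrableOn
      · have := hψc.continuous
        fun_prop
      · refine HasCompactSupport.intro (isCompact_Icc (a := (-1 : ℝ)) (b := 1)) fun y hy => ?_
        have : 1 ≤ y ^ 2 := by
          by_contra h
          exact hy (abs_le.1 ((sq_le_one_iff_abs_le_one y).1 (not_le.1 h).le))
        simp [hψ0 _ this]
    have hlim : Tendsto (fun y : ℝ => -2 * y ^ 2 * deriv g (y ^ 2)) atTop (nhds 2) := by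
      refine tendsto_const_nhds.congr' ?_
      filter_upwards [eventually_ge_atTop 1] with y hy
      have : 1 ≤ y ^ 2 := one_le_pow₀ hy
      rw [hdlog _ (by linarith)]
      field_simp
    rw [integral_Ioi_of_hasDerivAt_of_tendsto (hder 0).continuousAt.continuousWithinAt
      (fun y _ => hder y) hintg hlim]
    have hvol : 0 < volume.real (Metric.ball (0 : R2) 1) :=
      ENNReal.toReal_pos (Metric.measure_ball_pos _ _ one_pos).ne' measure_ball_lt_top.ne
    simp [hvol.ne']

/-- The convolution of `h` with the kernel `K`. -/
def conv (K h : R2 → ℝ) (x : R2) : ℝ := ∫ t, h t * K (x - t)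

lemma conv_eq_convolution (K h : R2 → ℝ) :
    conv K h = convolution h K (ContinuousLinearMap.mul ℝ ℝ) volume := rfl

lemma conv_const_mul (c : ℝ) (K h : R2 → ℝ) (x : R2) :
    conv (fun y => c * K y) h x = c * conv K h x := by
  simp only [conv, mul_left_comm _ c, integral_const_mul]

lemma integrable_conv {K h : R2 → ℝ} (hK : Continuous K) (hs : HasCompactSupport K)
    (hh : Continuous h) (x : R2) : Integrable fun t => h t * K (x - t) := by
  refine Continuous.integrable_of_hasCompactSupport (by fun_prop) ?_
  exact (hs.comp_homeomorph (Homeomorph.subLeft x)).mul_left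

lemma conv_sub {K K' h : R2 → ℝ} (hK : Continuous K) (hs : HasCompactSupport K)
    (hK' : Continuous K') (hs' : HasCompactSupport K') (hh : Continuous h) (x : R2) :
    conv (fun y => K y - K' y) h x = conv K h x - conv K' h x := by
  simp only [conv, mul_sub]
  exact integral_sub (integrable_conv hK hs hh x) (integrable_conv hK' hs' hh x)

lemma conv_add {K K' h : R2 → ℝ} (hK : Continuous K) (hs : HasCompactSupport K)
    (hK' : Continuous K') (hs' : HasCompactSupport K') (hh : Continuous h) (x : R2) :
    conv (fun y => K y + K' y) h x = conv K h x + conv K' h x := by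
  simp only [conv, mul_add]
  exact integral_add (integrable_conv hK hs hh x) (integrable_conv hK' hs' hh x)

lemma continuous_conv {K h : R2 → ℝ} (hK : Continuous K) (hs : HasCompactSupport K)
    (hh : Continuous h) : Continuous (conv K h) := by
  rw [conv_eq_convolution]
  exact hs.continuous_convolution_right _ hh.locallyIntegrable hK

lemma differentiable_conv {K h : R2 → ℝ} (hK : ContDiff ℝ 1 K) (hs : HasCompactSupport K)
    (hh : Continuous h) : Differentiable ℝ (conv K h) := fun x => by
  rw [conv_eq_convolution]
  exact (hs.hasFDerivAt_convolution_right _ hh.locallyIntegrable hK x).differentiableAt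

lemma partialDeriv_conv {K h : R2 → ℝ} (hK : ContDiff ℝ 1 K) (hs : HasCompactSupport K)
    (hh : Continuous h) (i : Fin 2) : partialDeriv i (conv K h) = conv (partialDeriv i K) h := by
  funext x
  rw [conv_eq_convolution, partialDeriv,
    (hs.hasFDerivAt_convolution_right _ hh.locallyIntegrable hK x).fderiv,
    convolution_precompR_apply _ hh.locallyIntegrable (hs.fderiv ℝ)
      (hK.continuous_fderiv (by simp))]
  rfl

lemma partialDeriv_comp_smul {K : R2 → ℝ} (hK : Differentiable ℝ K) (c : ℝ) (i : Fin 2) :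
    partialDeriv i (fun x => K (c • x)) = fun x => c * partialDeriv i K (c • x) := by
  funext x
  have h1 : HasFDerivAt (fun x : R2 => c • x) (c • ContinuousLinearMap.id ℝ R2) x :=
    (hasFDerivAt_id x).const_smul c
  have h2 := (hK (c • x)).hasFDerivAt.comp x h1
  rw [partialDeriv, HasFDerivAt.fderiv (f := fun x => K (c • x)) h2]
  simp [partialDeriv]

lemma partialDeriv_const_mul {K : R2 → ℝ} (hK : Differentiable ℝ K) (c : ℝ) (i : Fin 2) :
    partialDeriv i (fun x => c * K x) = fun x => c * partialDeriv i K x := by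
  funext x
  rw [partialDeriv, fderiv_const_mul (hK x)]
  rfl

lemma integral_comp_smul_plane (K : R2 → ℝ) {c : ℝ} :
    ∫ x, K (c • x) = (c ^ 2)⁻¹ * ∫ x, K x := by
  rw [Measure.integral_comp_smul]
  simp

lemma conv_eq_integral_sub (K h : R2 → ℝ) (x : R2) : conv K h x = ∫ t, h (x - t) * K t := by
  rw [conv, ← integral_sub_left_eq_self _ volume x]
  simp

lemma hasCompactSupport_comp_smul {K : R2 → ℝ} (hs : HasCompactSupport K) {c : ℝ} (hc : 0 < c) :
    HasCompactSupport fun x => K (c • x) :=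
  hs.comp_homeomorph (Homeomorph.smulOfNeZero c hc.ne')

lemma abs_conv_comp_smul_le {K h : R2 → ℝ} (hK : Continuous K) (hs : HasCompactSupport K)
    {B c : ℝ} (hB : ∀ x, |h x| ≤ B) (hc : 0 < c) (x : R2) :
    |conv (fun y => K (c • y)) h x| ≤ B * ((c ^ 2)⁻¹ * ∫ y, |K y|) := by
  rw [conv_eq_integral_sub, ← integral_comp_smul_plane (fun y => |K y|), ← integral_const_mul,
    ← Real.norm_eq_abs]
  refine norm_integral_le_of_norm_le ?_ (Eventually.of_forall fun t => ?_)
  · refine Integrable.const_mul ?_ _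
    have h1 : Continuous fun y => K (c • y) := by fun_prop
    exact (h1.integrable_of_hasCompactSupport (hasCompactSupport_comp_smul hs hc)).abs
  · rw [Real.norm_eq_abs, abs_mul]
    exact mul_le_mul_of_nonneg_right (hB _) (abs_nonneg _)

/-- Convolution with a kernel at scale `c⁻¹` is close to multiplication by its mass. -/
lemma abs_conv_comp_smul_sub_le {K h : R2 → ℝ} (hK : Continuous K) (hs : ∀ x, 1 < ‖x‖ → K x = 0)
    {L c : ℝ} (hh : Continuous h) (hL0 : 0 ≤ L) (hL : ∀ x y, |h x - h y| ≤ L * ‖x - y‖)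
    (hc : 0 < c) (x : R2) :
    |conv (fun y => K (c • y)) h x - (c ^ 2)⁻¹ * (∫ y, K y) * h x| ≤
      L * c⁻¹ * ((c ^ 2)⁻¹ * ∫ y, |K y|) := by
  have hKs := hasCompactSupport_comp_smul (hasCompactSupport_of_eq_zero hs) hc
  have hKc : Continuous fun y => K (c • y) := by fun_prop
  have hi : Integrable fun y => K (c • y) := hKc.integrable_of_hasCompactSupport hKs
  have hi2 : Integrable fun t => h (x - t) * K (c • t) := by
    refine Continuous.integrable_of_hasCompactSupport (by fun_prop) hKs.mul_left
  rw [conv_eq_integral_sub, ← integral_comp_smul_plane K, ← integral_mul_const,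
    ← integral_sub hi2 (hi.mul_const _), ← integral_comp_smul_plane (fun y => |K y|),
    ← integral_const_mul, ← Real.norm_eq_abs]
  refine norm_integral_le_of_norm_le (hi.abs.const_mul _) (Eventually.of_forall fun t => ?_)
  have e : h (x - t) * K (c • t) - K (c • t) * h x = (h (x - t) - h x) * K (c • t) := by ring
  rw [e, Real.norm_eq_abs, abs_mul]
  by_cases ht : 1 < ‖c • t‖
  · rw [hs _ ht]; simp
  · refine mul_le_mul_of_nonneg_right ((hL _ _).trans ?_) (abs_nonneg _)
    refine mul_le_mul_of_nonneg_left ?_ hL0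
    rw [norm_smul, Real.norm_of_nonneg hc.le, not_lt] at ht
    rw [sub_sub_cancel_left, norm_neg, ← one_div, le_div_iff₀ hc, mul_comm]
    exact ht

lemma integral_partialDeriv {K : R2 → ℝ} (hK : ContDiff ℝ 1 K) (hs : HasCompactSupport K)
    (i : Fin 2) : ∫ x, partialDeriv i K x = 0 := by
  have h1 : conv K (fun _ => 1) = fun _ => ∫ x, K x := by
    funext x; simp [conv_eq_integral_sub]
  have h2 := congrFun (partialDeriv_conv hK hs (continuous_const (y := (1 : ℝ))) i) 0
  rw [h1, conv_eq_integral_sub] at h2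
  simpa [partialDeriv] using h2.symm

lemma norm_le_abs_axis (T : R2 →L[ℝ] ℝ) : ‖T‖ ≤ |T (axis 0)| + |T (axis 1)| := by
  refine T.opNorm_le_bound (by positivity) fun x => ?_
  have hx : x = x 0 • (axis 0) + x 1 • (axis 1) := by
    ext i; fin_cases i <;> simp
  have h0 := EuclideanSpace.norm_eq x
  have hc : ∀ i, |x i| ≤ ‖x‖ := fun i => by simpa using PiLp.norm_apply_le x i
  rw [hx, map_add, map_smul, map_smul, ← hx]
  refine (norm_add_le _ _).trans ?_
  simp only [norm_smul, Real.norm_eq_abs]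
  nlinarith [hc 0, hc 1, abs_nonneg (T (axis 0)), abs_nonneg (T (axis 1))]

lemma differentiable_tsum_partialDeriv {g : ℕ → R2 → ℝ} {a : Fin 2 → ℕ → ℝ}
    (ha : ∀ i, Summable (a i)) (hg : ∀ n, Differentiable ℝ (g n))
    (hg' : ∀ i n x, |partialDeriv i (g n) x| ≤ a i n)
    (hg0 : ∀ x, Summable fun n => g n x) :
    Differentiable ℝ (fun x => ∑' n, g n x) ∧
      ∀ i, partialDeriv i (fun x => ∑' n, g n x) = fun x => ∑' n, partialDeriv i (g n) x := by
  have hbd : ∀ n x, ‖fderiv ℝ (g n) x‖ ≤ a 0 n + a 1 n := fun n x => by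
    refine (norm_le_abs_axis _).trans ?_
    have h0 := hg' 0 n x
    have h1 := hg' 1 n x
    unfold partialDeriv at h0 h1
    linarith
  have h := hasFDerivAt_tsum ((ha 0).add (ha 1)) (fun n x => (hg n x).hasFDerivAt) hbd (hg0 0)
  refine ⟨fun x => (h x).differentiableAt, fun i => funext fun x => ?_⟩
  rw [partialDeriv, (h x).fderiv]
  have hsum : Summable fun n => fderiv ℝ (g n) x :=
    Summable.of_norm_bounded ((ha 0).add (ha 1)) fun n => hbd n x
  exact (ContinuousLinearMap.apply ℝ ℝ (axis i)).map_tsum hsum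

lemma contDiff_succ_of_partialDeriv {n : ℕ} {u : R2 → ℝ} (hu : Differentiable ℝ u)
    (h : ∀ i, ContDiff ℝ n (partialDeriv i u)) : ContDiff ℝ (n + 1) u := by
  rw [contDiff_succ_iff_fderiv_apply]
  refine ⟨hu, fun h => by simp at h, fun y => ?_⟩
  have hy : y = y 0 • (axis 0) + y 1 • (axis 1) := by
    ext i; fin_cases i <;> simp
  rw [hy]
  simp only [map_add, map_smul]
  exact ((h 0).const_smul (y 0)).add ((h 1).const_smul (y 1))

lemma contDiff_two_of_partialDeriv {u : R2 → ℝ} (hu : Differentiable ℝ u)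
    (h : ∀ i, Differentiable ℝ (partialDeriv i u))
    (h' : ∀ i j, Continuous (partialDeriv j (partialDeriv i u))) : ContDiff ℝ 2 u := by
  have h1 : ∀ i, ContDiff ℝ 1 (partialDeriv i u) := fun i => by
    simpa using contDiff_succ_of_partialDeriv (n := 0) (h i) fun j => by
      exact_mod_cast contDiff_zero.2 (h' i j)
  have := contDiff_succ_of_partialDeriv (n := 1) hu (by simpa using h1)
  norm_num at this
  exact this

lemma lap_comp_affine {K : R2 → ℝ} (hK : ContDiff ℝ 2 K) (z t : R2) (c : ℝ) :
    lap (fun t => K (z + c • t)) t = c ^ 2 * lap K (z + c • t) := by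
  simp only [lap, Finset.mul_sum]
  refine Finset.sum_congr rfl fun i _ => ?_
  have h1 : ContDiff ℝ 2 fun s : ℝ => K (z + c • t + s • EuclideanSpace.single i (1 : ℝ)) :=
    hK.comp (contDiff_const.add (contDiff_id.smul contDiff_const))
  have h2 := congrFun (iteratedDeriv_comp_const_mul (n := 2) h1 c) 0
  rw [mul_zero] at h2
  rw [← h2]
  congr 1
  funext s
  rw [smul_add, smul_smul, add_assoc]

lemma lap_comp_smul {K : R2 → ℝ} (hK : ContDiff ℝ 2 K) (c : ℝ) :
    lap (fun t => K (c • t)) = fun t => c ^ 2 * lap K (c • t) := by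
  funext t
  simpa using lap_comp_affine hK 0 t c

lemma contDiff_conv {K h : R2 → ℝ} (hK : ContDiff ℝ 2 K) (hs : HasCompactSupport K)
    (hh : Continuous h) : ContDiff ℝ 2 (conv K h) := by
  rw [conv_eq_convolution]
  exact hs.contDiff_convolution_right (n := 2) _ hh.locallyIntegrable hK

lemma lap_conv {K h : R2 → ℝ} (hK : ContDiff ℝ 2 K) (hs : HasCompactSupport K)
    (hh : Continuous h) (x : R2) : lap (conv K h) x = conv (lap K) h x := by
  have hK1 : ContDiff ℝ 1 K := hK.of_le (by norm_num)
  have hp : ∀ i, ContDiff ℝ 1 (partialDeriv i K) := fun i => hK.partialDeriv (by norm_num) i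
  have hpp : ∀ i, Continuous (partialDeriv i (partialDeriv i K)) := fun i =>
    ((hp i).partialDeriv (m := 0) (by norm_num) i).continuous
  have h : lap K = fun x => partialDeriv 0 (partialDeriv 0 K) x +
      partialDeriv 1 (partialDeriv 1 K) x :=
    funext fun x => by rw [lap_eq_sum_partialDeriv hK.contDiffAt, Fin.sum_univ_two]
  rw [lap_eq_sum_partialDeriv (contDiff_conv hK hs hh).contDiffAt, Fin.sum_univ_two, h,
    conv_add (hpp 0) ((hs.partialDeriv 0).partialDeriv 0) (hpp 1) ((hs.partialDeriv 1).partialDeriv 1)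
      hh]
  simp only [partialDeriv_conv hK1 hs hh, partialDeriv_conv (hp _) (hs.partialDeriv _) hh]

lemma conv_lap_of_weak {Ω : Set R2} {u f : R2 → ℝ}
    (hw : ∀ φ : R2 → ℝ, ContDiff ℝ 2 φ → HasCompactSupport φ → tsupport φ ⊆ Ω →
        ∫ x, u x * lap φ x = -∫ x, f x * φ x)
    {K : R2 → ℝ} (hK : ContDiff ℝ 2 K) (hs : ∀ x, 1 < ‖x‖ → K x = 0) {c : ℝ} (hc : 0 < c)
    {x : R2} (hx : Metric.closedBall x c⁻¹ ⊆ Ω) :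
    c ^ 2 * conv (fun y => lap K (c • y)) u x = -conv (fun y => K (c • y)) f x := by
  have e : ∀ t, c • (x - t) = c • x + (-c) • t := fun t => by
    rw [smul_sub, neg_smul, sub_eq_add_neg]
  have hφ : ContDiff ℝ 2 fun t => K (c • (x - t)) :=
    hK.comp ((contDiff_const.sub contDiff_id).const_smul c)
  have hsupp : ∀ t, t ∉ Metric.closedBall x c⁻¹ → K (c • (x - t)) = 0 := fun t ht => by
    refine hs _ ?_
    rw [Metric.mem_closedBall, dist_comm, dist_eq_norm, not_le, inv_lt_iff_one_lt_mul₀ hc] at ht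
    rw [norm_smul, Real.norm_of_nonneg hc.le]
    rwa [mul_comm]
  have hcpt := HasCompactSupport.intro (isCompact_closedBall x c⁻¹) hsupp
  have hsub : tsupport (fun t => K (c • (x - t))) ⊆ Metric.closedBall x c⁻¹ :=
    closure_minimal (fun t ht => by_contra fun h => ht (hsupp t h)) Metric.isClosed_closedBall
  have h := hw _ hφ hcpt (hsub.trans hx)
  have hl : ∀ t, lap (fun t => K (c • (x - t))) t = c ^ 2 * lap K (c • (x - t)) := fun t => by
    simp only [e]
    rw [lap_comp_affine hK, neg_sq]
  simp only [hl, mul_left_comm _ (c ^ 2), integral_const_mul] at h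
  exact h

lemma tendsto_scaled_conv {K h : R2 → ℝ} (hK : Continuous K) (hs : ∀ x, 1 < ‖x‖ → K x = 0)
    {L : ℝ} (hL0 : 0 ≤ L) (hh : Continuous h) (hL : ∀ x y, |h x - h y| ≤ L * ‖x - y‖) (x : R2)
    (m : ℕ) :
    Tendsto (fun n : ℕ => ((2 : ℝ) ^ (m + n)) ^ 2 * conv (fun y => K ((2 : ℝ) ^ (m + n) • y)) h x)
      atTop (nhds ((∫ y, K y) * h x)) := by
  rw [tendsto_iff_norm_sub_tendsto_zero]
  have hlim : Tendsto (fun n : ℕ => L * ((2 : ℝ) ^ (m + n))⁻¹ * ∫ y, |K y|) atTop (nhds 0) := by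
    have h1 : Tendsto (fun n : ℕ => (2 : ℝ) ^ (m + n)) atTop atTop :=
      (tendsto_pow_atTop_atTop_of_one_lt (by norm_num)).comp
        (tendsto_atTop_mono (fun n => Nat.le_add_left n m) tendsto_id)
    simpa using ((tendsto_inv_atTop_zero.comp h1).const_mul L).mul_const (∫ y, |K y|)
  refine squeeze_zero (fun _ => norm_nonneg _) (fun n => ?_) hlim
  have hc : (0 : ℝ) < 2 ^ (m + n) := by positivity
  have h1 := abs_conv_comp_smul_sub_le hK hs hh hL0 hL hc x
  have h2 := mul_le_mul_of_nonneg_left h1 (sq_nonneg ((2 : ℝ) ^ (m + n)))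
  rw [← abs_of_nonneg (sq_nonneg ((2 : ℝ) ^ (m + n))), ← abs_mul,
    abs_of_nonneg (sq_nonneg ((2 : ℝ) ^ (m + n)))] at h2
  rw [Real.norm_eq_abs]
  have e1 : ∀ a b d : ℝ, ((2 : ℝ) ^ (m + n)) ^ 2 * (a - (((2 : ℝ) ^ (m + n)) ^ 2)⁻¹ * b * d) =
      ((2 : ℝ) ^ (m + n)) ^ 2 * a - b * d := fun a b d => by field_simp
  have e2 : ∀ a b : ℝ, ((2 : ℝ) ^ (m + n)) ^ 2 * (a * ((((2 : ℝ) ^ (m + n)) ^ 2)⁻¹ * b)) = a * b :=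
    fun a b => by field_simp
  rwa [e1, e2] at h2

/-- The sum of the small-scale pieces of the logarithmic potential of `f`. -/
lemma contDiff_tsum_conv {κ χ f : R2 → ℝ} (hκ : ContDiff ℝ 2 κ) (hχ : ContDiff ℝ 2 χ)
    (hκs : ∀ x, 1 < ‖x‖ → κ x = 0) (hχs : ∀ x, 1 < ‖x‖ → χ x = 0)
    (hκχ : ∀ x, lap κ x = χ x - 4 * χ ((2 : ℝ) • x)) {B L : ℝ} (hB : ∀ x, |f x| ≤ B)
    (hL0 : 0 ≤ L) (hf : Continuous f) (hL : ∀ x y, |f x - f y| ≤ L * ‖x - y‖) (m : ℕ) :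
    (∀ x, Summable fun n : ℕ => conv (fun y => κ ((2 : ℝ) ^ (m + n) • y)) f x) ∧
    ContDiff ℝ 2 (fun x => ∑' n : ℕ, conv (fun y => κ ((2 : ℝ) ^ (m + n) • y)) f x) ∧
    ∀ x, lap (fun x => ∑' n : ℕ, conv (fun y => κ ((2 : ℝ) ^ (m + n) • y)) f x) x =
      ((2 : ℝ) ^ m) ^ 2 * conv (fun y => χ ((2 : ℝ) ^ m • y)) f x - (∫ y, χ y) * f x := by
  set c : ℕ → ℝ := fun n => 2 ^ (m + n) with hc
  have hc0 : ∀ n, 0 < c n := fun n => by positivity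
  have hc1 : ∀ n, 1 ≤ c n := fun n => one_le_pow₀ (by norm_num)
  have hcs : Summable fun n => (c n)⁻¹ := by
    have : Summable fun n : ℕ => ((2 : ℝ) ^ m)⁻¹ * (1 / 2) ^ n :=
      (summable_geometric_of_lt_one (by norm_num) (by norm_num)).mul_left _
    refine this.congr fun n => ?_
    simp [hc, pow_add, mul_comm]
  have hκc := hasCompactSupport_of_eq_zero hκs
  have hχc := hasCompactSupport_of_eq_zero hχs
  have hκ1 : ContDiff ℝ 1 κ := hκ.of_le (by norm_num)
  have hp : ∀ i, ContDiff ℝ 1 (partialDeriv i κ) := fun i => hκ.partialDeriv (by norm_num) i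
  have hpp : ∀ i j, Continuous (partialDeriv j (partialDeriv i κ)) := fun i j =>
    ((hp i).partialDeriv (m := 0) (by norm_num) j).continuous
  have hps := fun i => hκc.partialDeriv i
  have hpps := fun i j => (hps i).partialDeriv j
  have hpp0 : ∀ i j x, 1 < ‖x‖ → partialDeriv j (partialDeriv i κ) x = 0 := by
    intro i j x hx
    have hsub : tsupport κ ⊆ Metric.closedBall 0 1 := closure_minimal
      (fun t ht => by_contra fun h => ht (hκs t (by simpa using h))) Metric.isClosed_closedBall
    refine image_eq_zero_of_notMem_tsupport fun h => ?_
    have := hsub (((tsupport_fderiv_apply_subset ℝ _).trans (tsupport_fderiv_apply_subset ℝ _)) h)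
    rw [Metric.mem_closedBall, dist_zero_right] at this
    linarith
  have scale : ∀ {K : R2 → ℝ} {n : WithTop ℕ∞} (hK : ContDiff ℝ n K) (k : ℕ),
      ContDiff ℝ n fun y => K (c k • y) := fun hK k => hK.comp (contDiff_id.const_smul (c k))
  have hd1 : ∀ i n, partialDeriv i (conv (fun y => κ (c n • y)) f) =
      fun x => c n * conv (fun y => partialDeriv i κ (c n • y)) f x := fun i n => by
    rw [partialDeriv_conv (scale hκ1 n) (hasCompactSupport_comp_smul hκc (hc0 n)) hf,
      partialDeriv_comp_smul (hκ1.differentiable (by simp))]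
    funext x
    exact conv_const_mul _ _ _ _
  have hD1 : ∀ i n, Differentiable ℝ (conv (fun y => partialDeriv i κ (c n • y)) f) := fun i n =>
    differentiable_conv (scale (hp i) n) (hasCompactSupport_comp_smul (hps i) (hc0 n)) hf
  have hd2 : ∀ i j n, partialDeriv j (partialDeriv i (conv (fun y => κ (c n • y)) f)) =
      fun x => c n ^ 2 * conv (fun y => partialDeriv j (partialDeriv i κ) (c n • y)) f x := by
    intro i j n
    rw [hd1, partialDeriv_const_mul (hD1 i n),
      partialDeriv_conv (scale (hp i) n) (hasCompactSupport_comp_smul (hps i) (hc0 n)) hf,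
      partialDeriv_comp_smul ((hp i).differentiable (by simp))]
    funext x
    rw [conv_const_mul, ← mul_assoc, sq]
  have hb0 : ∀ n x, ‖conv (fun y => κ (c n • y)) f x‖ ≤ |B| * (∫ y, |κ y|) * (c n)⁻¹ := by
    intro n x
    refine (abs_conv_comp_smul_le hκ.continuous hκc (fun x => (hB x).trans (le_abs_self B))
      (hc0 n) x).trans ?_
    rw [mul_comm (c n ^ 2)⁻¹, ← mul_assoc]
    refine mul_le_mul_of_nonneg_left ?_ (by positivity)
    exact inv_anti₀ (hc0 n) (le_self_pow₀ (hc1 n) (by norm_num))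
  have hb1 : ∀ i n x, |partialDeriv i (conv (fun y => κ (c n • y)) f) x| ≤
      B * (∫ y, |partialDeriv i κ y|) * (c n)⁻¹ := by
    intro i n x
    rw [hd1, abs_mul, abs_of_pos (hc0 n)]
    have h1 := mul_le_mul_of_nonneg_left (abs_conv_comp_smul_le (hp i).continuous (hps i) hB
      (hc0 n) x) (hc0 n).le
    refine h1.trans (le_of_eq ?_)
    have := (hc0 n).ne'
    field_simp
  have hb2 : ∀ i j n x, |partialDeriv j (partialDeriv i (conv (fun y => κ (c n • y)) f)) x| ≤
      L * (∫ y, |partialDeriv j (partialDeriv i κ) y|) * (c n)⁻¹ := by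
    intro i j n x
    rw [hd2, abs_mul, abs_of_nonneg (sq_nonneg (c n))]
    have h0 := abs_conv_comp_smul_sub_le (hpp i j) (hpp0 i j) hf hL0 hL (hc0 n) x
    rw [integral_partialDeriv (hp i) (hps i), mul_zero, zero_mul, sub_zero] at h0
    refine (mul_le_mul_of_nonneg_left h0 (sq_nonneg (c n))).trans (le_of_eq ?_)
    have := (hc0 n).ne'
    field_simp
  have hs0 : ∀ x, Summable fun n => conv (fun y => κ (c n • y)) f x := fun x =>
    Summable.of_norm_bounded (hcs.mul_left _) fun n => hb0 n x
  have hs1 : ∀ i x, Summable fun n => partialDeriv i (conv (fun y => κ (c n • y)) f) x :=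
    fun i x => Summable.of_norm_bounded (hcs.mul_left _) fun n => hb1 i n x
  have hs2 : ∀ i x, Summable fun n =>
      partialDeriv i (partialDeriv i (conv (fun y => κ (c n • y)) f)) x :=
    fun i x => Summable.of_norm_bounded (hcs.mul_left _) fun n => hb2 i i n x
  obtain ⟨hS, hS1⟩ := differentiable_tsum_partialDeriv (fun i => hcs.mul_left _)
    (fun n => differentiable_conv (scale hκ1 n) (hasCompactSupport_comp_smul hκc (hc0 n)) hf)
    hb1 hs0
  have hSi := fun i => differentiable_tsum_partialDeriv (fun j => hcs.mul_left _)
    (fun n => by rw [hd1]; exact (hD1 i n).const_mul _) (fun j n x => hb2 i j n x) (hs1 i)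
  have hC2 : ContDiff ℝ 2 (fun x => ∑' n : ℕ, conv (fun y => κ (c n • y)) f x) := by
    refine contDiff_two_of_partialDeriv hS (fun i => by rw [hS1]; exact (hSi i).1) fun i j => ?_
    rw [hS1, (hSi i).2]
    refine continuous_tsum (fun n => ?_) (hcs.mul_left _) fun n x => hb2 i j n x
    rw [hd2]
    exact continuous_const.mul (continuous_conv ((hpp i j).comp (continuous_const_smul _))
      (hasCompactSupport_comp_smul (hpps i j) (hc0 n)) hf)
  refine ⟨hs0, hC2, fun x => ?_⟩
  have hlap : ∀ n, lap (conv (fun y => κ (c n • y)) f) x =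
      c n ^ 2 * conv (fun y => χ (c n • y)) f x -
        c (n + 1) ^ 2 * conv (fun y => χ (c (n + 1) • y)) f x := by
    intro n
    have e : ∀ y : R2, lap κ (c n • y) = χ (c n • y) - 4 * χ (c (n + 1) • y) := fun y => by
      rw [hκχ, smul_smul]
      congr 4
      simp only [hc]; ring
    have hcc : ∀ k, Continuous fun y => χ (c k • y) := fun k => (scale hχ k).continuous
    have hcs' := fun k => hasCompactSupport_comp_smul hχc (hc0 k)
    rw [lap_conv (scale hκ n) (hasCompactSupport_comp_smul hκc (hc0 n)) hf, lap_comp_smul hκ,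
      conv_const_mul]
    simp only [e]
    rw [conv_sub (K' := fun y => 4 * χ (c (n + 1) • y)) (hcc n) (hcs' n)
      (continuous_const.mul (hcc (n + 1))) (hcs' (n + 1)).mul_left hf, conv_const_mul]
    have : c (n + 1) = 2 * c n := by simp only [hc]; ring
    rw [this]
    ring
  have hlapW : ∀ n, lap (conv (fun y => κ (c n • y)) f) x =
      partialDeriv 0 (partialDeriv 0 (conv (fun y => κ (c n • y)) f)) x +
      partialDeriv 1 (partialDeriv 1 (conv (fun y => κ (c n • y)) f)) x := fun n => by
    rw [lap_eq_sum_partialDeriv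
      (contDiff_conv (scale hκ n) (hasCompactSupport_comp_smul hκc (hc0 n)) hf).contDiffAt,
      Fin.sum_univ_two]
  have hsum : HasSum (fun n => lap (conv (fun y => κ (c n • y)) f) x)
      (lap (fun x => ∑' n : ℕ, conv (fun y => κ (c n • y)) f x) x) := by
    rw [lap_eq_sum_partialDeriv hC2.contDiffAt, Fin.sum_univ_two, hS1, hS1, (hSi 0).2, (hSi 1).2]
    simp only [hlapW]
    exact (hs2 0 x).hasSum.add (hs2 1 x).hasSum
  refine tendsto_nhds_unique hsum.tendsto_sum_nat ?_
  simp only [hlap, Finset.sum_range_sub']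
  exact (tendsto_scaled_conv hχ.continuous hχs hL0 hf hL x m).const_sub _

lemma partialDeriv_linear_comb {v w : R2 → ℝ} (hv : Differentiable ℝ v) (hw : Differentiable ℝ w)
    (a b : ℝ) (i : Fin 2) : partialDeriv i (fun x => a * v x + b * w x) =
      fun x => a * partialDeriv i v x + b * partialDeriv i w x := by
  funext x
  have h := ((hv x).hasFDerivAt.const_mul a).add ((hw x).hasFDerivAt.const_mul b)
  rw [partialDeriv, HasFDerivAt.fderiv (f := fun x => a * v x + b * w x) h]
  simp [partialDeriv]

lemma lap_linear_comb {v w : R2 → ℝ} (hv : ContDiff ℝ 2 v) (hw : ContDiff ℝ 2 w) (a b : ℝ)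
    (p : R2) : lap (fun x => a * v x + b * w x) p = a * lap v p + b * lap w p := by
  have hd : ∀ {g : R2 → ℝ}, ContDiff ℝ 2 g → ∀ i, Differentiable ℝ (partialDeriv i g) :=
    fun hg i => (hg.partialDeriv (m := 1) (by norm_num) i).differentiable (by simp)
  rw [lap_eq_sum_partialDeriv ((contDiff_const.mul hv).add (contDiff_const.mul hw)).contDiffAt,
    lap_eq_sum_partialDeriv hv.contDiffAt, lap_eq_sum_partialDeriv hw.contDiffAt]
  simp only [Fin.sum_univ_two, partialDeriv_linear_comb (hv.differentiable (by simp))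
    (hw.differentiable (by simp)), partialDeriv_linear_comb (hd hv _) (hd hw _)]
  ring

lemma lap_congr_of_eventuallyEq {v w : R2 → ℝ} {p : R2} (h : v =ᶠ[nhds p] w) :
    lap v p = lap w p := by
  unfold lap
  refine Finset.sum_congr rfl fun i _ => Filter.EventuallyEq.iteratedDeriv_eq 2 ?_
  have hc : Tendsto (fun t : ℝ => p + t • EuclideanSpace.single i (1 : ℝ)) (nhds 0) (nhds p) := by
    have : Continuous fun t : ℝ => p + t • (EuclideanSpace.single i (1 : ℝ) : R2) := by fun_prop
    simpa using this.tendsto 0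
  exact hc.eventually h

/-- Interior regularity for the Poisson equation with a Lipschitz right-hand side. -/
lemma contDiffOn_of_weak {Ω : Set R2} (hΩ : IsOpen Ω) {u f : R2 → ℝ} {B L L' : ℝ}
    (hL0 : 0 ≤ L) (hL : ∀ x y, |u x - u y| ≤ L * ‖x - y‖)
    (hB : ∀ x, |f x| ≤ B) (hL0' : 0 ≤ L') (hL' : ∀ x y, |f x - f y| ≤ L' * ‖x - y‖)
    (hw : ∀ φ : R2 → ℝ, ContDiff ℝ 2 φ → HasCompactSupport φ → tsupport φ ⊆ Ω →
        ∫ x, u x * lap φ x = -∫ x, f x * φ x) :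
    ContDiffOn ℝ 2 u Ω ∧ ∀ p ∈ Ω, -lap u p = f p := by
  obtain ⟨κ, χ, hκ, hχ, hκs, hχs, hκχ, hM⟩ := exists_dyadic_kernel
  have hcont : ∀ {v : R2 → ℝ} {C : ℝ}, 0 ≤ C → (∀ x y, |v x - v y| ≤ C * ‖x - y‖) →
      Continuous v := fun {v C} h0 h => by
    refine (LipschitzWith.of_dist_le_mul (K := ⟨C, h0⟩) fun x y => ?_).continuous
    rw [Real.dist_eq, dist_eq_norm]; exact h x y
  have hu := hcont hL0 hL
  have hf := hcont hL0' hL'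
  have hχc := hasCompactSupport_of_eq_zero hχs
  set M := ∫ y, χ y with hMdef
  suffices h : ∀ p ∈ Ω, ContDiffAt ℝ 2 u p ∧ -lap u p = f p from
    ⟨fun p hp => (h p hp).1.contDiffWithinAt, fun p hp => (h p hp).2⟩
  intro p hp
  obtain ⟨r, hr, hrΩ⟩ := Metric.isOpen_iff.1 hΩ p hp
  obtain ⟨m, hm⟩ := exists_pow_lt_of_lt_one (half_pos hr) (by norm_num : (1 / 2 : ℝ) < 1)
  have hball : ∀ x ∈ Metric.ball p (r / 2), ∀ n : ℕ,
      Metric.closedBall x ((2 : ℝ) ^ (m + n))⁻¹ ⊆ Ω := by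
    intro x hx n y hy
    refine hrΩ ?_
    have h1 : ((2 : ℝ) ^ (m + n))⁻¹ ≤ (1 / 2) ^ m := by
      rw [one_div, inv_pow]
      exact inv_anti₀ (by positivity) (pow_le_pow_right₀ (by norm_num) (Nat.le_add_right m n))
    rw [Metric.mem_ball] at hx ⊢
    rw [Metric.mem_closedBall] at hy
    linarith [dist_triangle y x p]
  obtain ⟨hsum, hC2, hlap⟩ := contDiff_tsum_conv hκ hχ hκs hχs hκχ hB hL0' hf hL' m
  have hscale : ∀ k : ℝ, ContDiff ℝ 2 fun y : R2 => χ (k • y) := fun k =>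
    hχ.comp (contDiff_id.const_smul k)
  have hcm : (0 : ℝ) < 2 ^ m := by positivity
  have hY := contDiff_conv (hscale (2 ^ m)) (hasCompactSupport_comp_smul hχc hcm) hu
  set S := fun x => ∑' n : ℕ, conv (fun y => κ ((2 : ℝ) ^ (m + n) • y)) f x with hS
  set Y := conv (fun y => χ ((2 : ℝ) ^ m • y)) u with hYdef
  have hrep : ∀ x ∈ Metric.ball p (r / 2), u x = M⁻¹ * ((2 : ℝ) ^ m) ^ 2 * Y x + M⁻¹ * S x := by
    intro x hx
    have hstep : ∀ n : ℕ, conv (fun y => κ ((2 : ℝ) ^ (m + n) • y)) f x =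
        ((2 : ℝ) ^ (m + (n + 1))) ^ 2 * conv (fun y => χ ((2 : ℝ) ^ (m + (n + 1)) • y)) u x -
        ((2 : ℝ) ^ (m + n)) ^ 2 * conv (fun y => χ ((2 : ℝ) ^ (m + n) • y)) u x := by
      intro n
      have hc : (0 : ℝ) < 2 ^ (m + n) := by positivity
      have hc' : (0 : ℝ) < 2 ^ (m + (n + 1)) := by positivity
      have h1 := conv_lap_of_weak hw hκ hκs hc (hball x hx n)
      have e : ∀ y : R2, lap κ ((2 : ℝ) ^ (m + n) • y) =
          χ ((2 : ℝ) ^ (m + n) • y) - 4 * χ ((2 : ℝ) ^ (m + (n + 1)) • y) := fun y => by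
        rw [hκχ, smul_smul]
        congr 4
        ring
      simp only [e] at h1
      rw [conv_sub (K' := fun y => 4 * χ ((2 : ℝ) ^ (m + (n + 1)) • y)) (hscale _).continuous
        (hasCompactSupport_comp_smul hχc hc) (continuous_const.mul (hscale _).continuous)
        (hasCompactSupport_comp_smul hχc hc').mul_left hu, conv_const_mul] at h1
      have e2 : ((2 : ℝ) ^ (m + (n + 1))) ^ 2 = 4 * ((2 : ℝ) ^ (m + n)) ^ 2 := by ring
      rw [e2]
      linarith
    have h2 := (hsum x).hasSum.tendsto_sum_nat
    simp only [hstep] at h2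
    have h3 := h2.congr fun n => Finset.sum_range_sub (fun n => ((2 : ℝ) ^ (m + n)) ^ 2 *
      conv (fun y => χ ((2 : ℝ) ^ (m + n) • y)) u x) n
    have h4 := tendsto_nhds_unique h3
      ((tendsto_scaled_conv hχ.continuous hχs hL0 hu hL x m).sub_const _)
    simp only [← hstep] at h4
    change S x = M * u x - (2 ^ m) ^ 2 * Y x at h4
    rw [h4]
    field_simp
    ring
  have hv : ContDiff ℝ 2 fun x => M⁻¹ * ((2 : ℝ) ^ m) ^ 2 * Y x + M⁻¹ * S x :=
    (contDiff_const.mul hY).add (contDiff_const.mul hC2)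
  have heq : u =ᶠ[nhds p] fun x => M⁻¹ * ((2 : ℝ) ^ m) ^ 2 * Y x + M⁻¹ * S x :=
    Filter.eventually_of_mem (Metric.ball_mem_nhds p (half_pos hr)) hrep
  have hup : ContDiffAt ℝ 2 u p := hv.contDiffAt.congr_of_eventuallyEq heq
  refine ⟨hup, ?_⟩
  have hYlap := conv_lap_of_weak hw hχ hχs hcm
    (by simpa using hball p (Metric.mem_ball_self (half_pos hr)) 0)
  rw [lap_congr_of_eventuallyEq heq, lap_linear_comb hY hC2, hlap, hYdef,
    lap_conv (hscale _) (hasCompactSupport_comp_smul hχc hcm) hu, lap_comp_smul hχ,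
    conv_const_mul, hYlap]
  field_simp
  ring

/-- The Hausdorff measure of the boundary of an open convex set is monotone: it is at most that of
the boundary of any compact set containing it. -/
lemma Convex.hausdorffMeasure_frontier_le {E : Type*} [NormedAddCommGroup E]
    [InnerProductSpace ℝ E] [CompleteSpace E] [MeasurableSpace E] [BorelSpace E] {Ω R : Set E}
    (hc : Convex ℝ Ω) (hΩ : IsOpen Ω) (hne : Ω.Nonempty) (hR : IsCompact R) (hsub : Ω ⊆ R)
    {d : ℝ} (hd : 0 ≤ d) : μH[d] (frontier Ω) ≤ μH[d] (frontier R) := by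
  have key : ∀ z : frontier Ω, ∃ y ∈ frontier R, ∃ t : ℝ, 0 ≤ t ∧ ∃ n : E, y = z + t • n ∧
      ∀ x ∈ closure Ω, inner ℝ n x ≤ inner ℝ n (z : E) := by
    rintro ⟨z, hz⟩
    have hzR : z ∈ R := hR.isClosed.closure_subset_iff.2 hsub (frontier_subset_closure hz)
    have hzΩ : z ∉ Ω := by
      rw [hΩ.frontier_eq] at hz
      exact hz.2
    obtain ⟨f, hf⟩ := geometric_hahn_banach_open_point hc hΩ hzΩ
    set n := (InnerProductSpace.toDual ℝ E).symm f with hn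
    have hnf : ∀ x, inner ℝ n x = f x := fun x => by
      rw [hn, InnerProductSpace.toDual_symm_apply]
    have hn0 : n ≠ 0 := by
      obtain ⟨x, hx⟩ := hne
      intro h
      have := hf x hx
      rw [← hnf, ← hnf, h] at this
      simp at this
    have hcl : Topology.IsClosedEmbedding fun t : ℝ => z + t • n :=
      (Homeomorph.addLeft z).isClosedEmbedding.comp (isClosedEmbedding_smul_left hn0)
    have hT : IsCompact ((fun t : ℝ => z + t • n) ⁻¹' R) := hcl.isCompact_preimage hR
    obtain ⟨t, htR, ht⟩ := hT.exists_isGreatest ⟨0, by simpa using hzR⟩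
    have ht0 : 0 ≤ t := ht (show (0 : ℝ) ∈ _ by simpa using hzR)
    refine ⟨z + t • n, ⟨subset_closure htR, fun hintg => ?_⟩, t, ht0, n, rfl, ?_⟩
    · have h1 : ∀ᶠ s in nhds t, z + s • n ∈ R :=
        hcl.continuous.continuousAt (mem_interior_iff_mem_nhds.1 hintg)
      obtain ⟨s, hs, hst⟩ := ((h1.filter_mono nhdsWithin_le_nhds).and
        (self_mem_nhdsWithin : Ioi t ∈ nhdsWithin t (Ioi t))).exists
      exact absurd (ht hs) (not_le.2 hst)
    · have hcls : IsClosed {x | inner ℝ n x ≤ inner ℝ n z} :=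
        isClosed_le (by fun_prop) continuous_const
      refine fun x hx => hcls.closure_subset_iff.2 (fun y hy => ?_) hx
      simpa only [mem_ofPred_eq, hnf] using (hf y hy).le
  choose g hgR t ht n hgn hn using key
  have hg : AntilipschitzWith 1 g := AntilipschitzWith.of_le_mul_dist fun z w => by
    have h1 := hn z w (frontier_subset_closure w.2)
    have h2 := hn w z (frontier_subset_closure z.2)
    have h3 : inner ℝ ((z : E) - w) (g z - g w) = ‖(z : E) - w‖ ^ 2
        + t z * (inner ℝ (n z) (z : E) - inner ℝ (n z) (w : E))
        + t w * (inner ℝ (n w) (w : E) - inner ℝ (n w) (z : E)) := by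
      rw [hgn, hgn, show (z : E) + t z • n z - (w + t w • n w)
        = ((z : E) - w) + t z • n z - t w • n w by abel, inner_sub_right, inner_add_right,
        real_inner_self_eq_norm_sq, real_inner_smul_right, real_inner_smul_right,
        real_inner_comm (n z), real_inner_comm (n w), inner_sub_right, inner_sub_right]
      ring
    have h4 := real_inner_le_norm ((z : E) - w) (g z - g w)
    have h5 := mul_nonneg (ht z) (sub_nonneg.2 h1)
    have h6 := mul_nonneg (ht w) (sub_nonneg.2 h2)
    rw [NNReal.coe_one, one_mul, Subtype.dist_eq, dist_eq_norm, dist_eq_norm]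
    by_contra! h
    nlinarith [norm_nonneg (g z - g w)]
  have h1 := hg.le_hausdorffMeasure_image hd univ
  have h2 := (isometry_subtype_coe (s := frontier Ω)).hausdorffMeasure_image (.inl hd) univ
  rw [image_univ, Subtype.range_coe] at h2
  rw [h2]
  refine h1.trans ?_
  simp only [ENNReal.coe_one, ENNReal.one_rpow, one_mul, image_univ]
  exact measure_mono (range_subset_iff.2 hgR)

/-- The quarter turn of a vector of the plane. -/
def quarterTurn (e : R2) : R2 := !₂[-e 1, e 0]

lemma inner_eq (x y : R2) : inner ℝ x y = x 0 * y 0 + x 1 * y 1 := by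
  simp [PiLp.inner_apply, mul_comm]

lemma norm_sq_eq (x : R2) : ‖x‖ ^ 2 = x 0 ^ 2 + x 1 ^ 2 := by
  rw [← real_inner_self_eq_norm_sq, inner_eq]; ring

lemma norm_quarterTurn (e : R2) : ‖quarterTurn e‖ = ‖e‖ := by
  have : ‖quarterTurn e‖ ^ 2 = ‖e‖ ^ 2 := by
    rw [norm_sq_eq, norm_sq_eq]; simp [quarterTurn]; ring
  exact (pow_left_inj₀ (norm_nonneg _) (norm_nonneg _) two_ne_zero).1 this

lemma eq_inner_smul_add {e : R2} (he : ‖e‖ = 1) (x : R2) :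
    x = inner ℝ e x • e + inner ℝ (quarterTurn e) x • quarterTurn e := by
  have h := norm_sq_eq e
  rw [he] at h
  ext i
  fin_cases i <;> simp [inner_eq, quarterTurn] <;> linear_combination (x _) * h

lemma hausdorffMeasure_segment_le {e : R2} (he : ‖e‖ = 1) (c : R2) (a b : ℝ) :
    μH[1] ((fun s : ℝ => c + s • e) '' Icc a b) ≤ ENNReal.ofReal (b - a) := by
  have h : LipschitzWith 1 fun s : ℝ => c + s • e := LipschitzWith.of_dist_le_mul fun s t => by
    rw [dist_add_left, dist_eq_norm, ← sub_smul, norm_smul, he]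
    simp [Real.dist_eq]
  refine (h.hausdorffMeasure_image_le zero_le_one _).trans ?_
  simp [hausdorffMeasure_real]

/-- The closed rectangle with sides along `e` and its quarter turn. -/
def rectangle (e : R2) (α β a b : ℝ) : Set R2 :=
  {x | inner ℝ e x ∈ Icc α β ∧ inner ℝ (quarterTurn e) x ∈ Icc a b}

lemma isCompact_rectangle {e : R2} (he : ‖e‖ = 1) (α β a b : ℝ) :
    IsCompact (rectangle e α β a b) := by
  have h : IsCompact ((fun s : ℝ × ℝ => s.1 • e + s.2 • quarterTurn e) '' (Icc α β ×ˢ Icc a b)) :=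
    (isCompact_Icc.prod isCompact_Icc).image (by fun_prop)
  refine h.of_isClosed_subset ?_ fun x hx => ⟨(_, _), hx, (eq_inner_smul_add he x).symm⟩
  exact (isClosed_Icc.preimage (by fun_prop : Continuous fun x : R2 => inner ℝ e x)).inter
    (isClosed_Icc.preimage (by fun_prop : Continuous fun x : R2 => inner ℝ (quarterTurn e) x))

lemma hausdorffMeasure_frontier_rectangle_le {e : R2} (he : ‖e‖ = 1) {α β a b : ℝ}
    (hαβ : α ≤ β) (hab : a ≤ b) :
    μH[1] (frontier (rectangle e α β a b)) ≤ ENNReal.ofReal (2 * ((β - α) + (b - a))) := by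
  have hν : ‖quarterTurn e‖ = 1 := (norm_quarterTurn e).trans he
  set V : ℝ → Set R2 := fun s => (fun t : ℝ => s • e + t • quarterTurn e) '' Icc a b
  set W : ℝ → Set R2 := fun t => (fun s : ℝ => t • quarterTurn e + s • e) '' Icc α β
  have hsub : frontier (rectangle e α β a b) ⊆ (V α ∪ V β) ∪ (W a ∪ W b) := by
    intro x hx
    have hxR := (isCompact_rectangle he α β a b).isClosed.frontier_subset hx
    have hdec := eq_inner_smul_add he x
    by_contra hnot
    simp only [mem_union, not_or] at hnot
    obtain ⟨⟨h1, h2⟩, h3, h4⟩ := hnot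
    have k1 : α ≠ inner ℝ e x := by
      rintro rfl
      exact h1 ⟨_, hxR.2, hdec.symm⟩
    have k2 : inner ℝ e x ≠ β := by
      rintro rfl
      exact h2 ⟨_, hxR.2, hdec.symm⟩
    have k3 : a ≠ inner ℝ (quarterTurn e) x := by
      rintro rfl
      exact h3 ⟨_, hxR.1, ((add_comm _ _).trans hdec.symm)⟩
    have k4 : inner ℝ (quarterTurn e) x ≠ b := by
      rintro rfl
      exact h4 ⟨_, hxR.1, ((add_comm _ _).trans hdec.symm)⟩
    have hopen : IsOpen ((fun x : R2 => inner ℝ e x) ⁻¹' Ioo α β ∩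
        (fun x : R2 => inner ℝ (quarterTurn e) x) ⁻¹' Ioo a b) :=
      (isOpen_Ioo.preimage (by fun_prop)).inter (isOpen_Ioo.preimage (by fun_prop))
    refine hx.2 (interior_maximal ?_ hopen ⟨⟨hxR.1.1.lt_of_ne k1, hxR.1.2.lt_of_ne k2⟩,
      hxR.2.1.lt_of_ne k3, hxR.2.2.lt_of_ne k4⟩)
    exact fun y hy => ⟨Ioo_subset_Icc_self hy.1, Ioo_subset_Icc_self hy.2⟩
  have hV : ∀ s, μH[1] (V s) ≤ ENNReal.ofReal (b - a) := fun s =>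
    hausdorffMeasure_segment_le hν _ _ _
  have hW : ∀ s, μH[1] (W s) ≤ ENNReal.ofReal (β - α) := fun s =>
    hausdorffMeasure_segment_le he _ _ _
  calc μH[1] (frontier (rectangle e α β a b))
      ≤ (μH[1] (V α) + μH[1] (V β)) + (μH[1] (W a) + μH[1] (W b)) :=
        (measure_mono hsub).trans ((measure_union_le _ _).trans
          (add_le_add (measure_union_le _ _) (measure_union_le _ _)))
    _ ≤ (ENNReal.ofReal (b - a) + ENNReal.ofReal (b - a))
        + (ENNReal.ofReal (β - α) + ENNReal.ofReal (β - α)) :=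
        add_le_add (add_le_add (hV _) (hV _)) (add_le_add (hW _) (hW _))
    _ = ENNReal.ofReal (2 * ((β - α) + (b - a))) := by
        have h1 := sub_nonneg.2 hab
        have h2 := sub_nonneg.2 hαβ
        rw [← ENNReal.ofReal_add h1 h1, ← ENNReal.ofReal_add h2 h2,
          ← ENNReal.ofReal_add (by positivity) (by positivity)]
        congr 1
        ring

/-- A convex set contains a triangle, hence half of the parallelogram, spanned by three of its
points. -/
lemma Convex.abs_det_div_two_le_volume {K : Set R2} (hK : Convex ℝ K) {p q w : R2}
    (hp : p ∈ K) (hq : q ∈ K) (hw : w ∈ K) :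
    ENNReal.ofReal |inner ℝ (quarterTurn (q - p)) (w - p)| ≤ 2 * volume K := by
  have hvol : volume (parallelepiped ![q - p, w - p])
      = ENNReal.ofReal |inner ℝ (quarterTurn (q - p)) (w - p)| := by
    rw [← (EuclideanSpace.basisFun (Fin 2) ℝ).addHaar_eq_volume,
      Measure.addHaar_parallelepiped, Module.Basis.det_apply, Matrix.det_fin_two]
    simp [Module.Basis.toMatrix_apply, inner_eq, quarterTurn]
    congr 2
    ring
  have hsub : parallelepiped ![q - p, w - p] ⊆
      (fun x => p + x) ⁻¹' K ∪ (fun x => (q + w - p) - x) ⁻¹' K := by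
    intro x hx
    rw [mem_parallelepiped_iff] at hx
    obtain ⟨t, ht, rfl⟩ := hx
    have h0 : (0 : ℝ) ≤ t 0 := ht.1 0
    have h1 : (0 : ℝ) ≤ t 1 := ht.1 1
    have h2 : t 0 ≤ 1 := ht.2 0
    have h3 : t 1 ≤ 1 := ht.2 1
    have hcomb : ∀ a b : ℝ, 0 ≤ a → 0 ≤ b → a + b ≤ 1 → p + a • (q - p) + b • (w - p) ∈ K := by
      intro a b ha hb hab
      have := hK.sum_mem (t := Finset.univ) (w := ![1 - a - b, a, b]) (z := ![p, q, w])
        (by intro i _; fin_cases i <;> simp <;> linarith)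
        (by simp [Fin.sum_univ_three]; ring) (by intro i _; fin_cases i <;> simp [hp, hq, hw])
      convert this using 1
      simp [Fin.sum_univ_three]
      module
    simp only [Fin.sum_univ_two, Matrix.cons_val_zero, Matrix.cons_val_one]
    rcases le_total (t 0 + t 1) 1 with h | h
    · left
      have := hcomb _ _ h0 h1 h
      rwa [mem_preimage, ← add_assoc]
    · right
      have := hcomb (1 - t 0) (1 - t 1) (by linarith) (by linarith) (by linarith)
      rw [mem_preimage]
      convert this using 1
      module
  rw [← hvol, two_mul]
  refine (measure_mono hsub).trans ((measure_union_le _ _).trans (add_le_add ?_ ?_))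
  · rw [measure_preimage_add]
  · exact ((Measure.measurePreserving_sub_left volume _).measure_preimage
      (hK.nullMeasurableSet volume)).le

/-- An open bounded convex set of diameter `D` lies in a strip of width `H ≤ D` such that its area
is at least `D * H / 4` and its perimeter is at most `2 * (D + H)`. -/
lemma exists_strip {Ω : Set R2} (hΩ : IsOpen Ω) (hb : Bornology.IsBounded Ω) (hc : Convex ℝ Ω)
    (hne : Ω.Nonempty) : ∃ (ν : R2) (a b D : ℝ), ‖ν‖ = 1 ∧
      (∀ x ∈ Ω, a ≤ inner ℝ ν x ∧ inner ℝ ν x ≤ b) ∧ 0 < b - a ∧ b - a ≤ D ∧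
      D * (b - a) / 4 ≤ volume.real Ω ∧
      (μH[1] (frontier Ω)).toReal ≤ 2 * (D + (b - a)) := by
  have hK : IsCompact (closure Ω) := hb.isCompact_closure
  have hKc : Convex ℝ (closure Ω) := hc.closure
  have hKne : (closure Ω).Nonempty := hne.closure
  obtain ⟨⟨p, q⟩, ⟨hp, hq⟩, hmax⟩ := (hK.prod hK).exists_isMaxOn (hKne.prod hKne)
    (f := fun z : R2 × R2 => dist z.1 z.2) (by fun_prop)
  have hD : ∀ x ∈ closure Ω, ∀ y ∈ closure Ω, ‖x - y‖ ≤ ‖q - p‖ := fun x hx y hy => by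
    have := hmax (show (x, y) ∈ closure Ω ×ˢ closure Ω from ⟨hx, hy⟩)
    simpa only [mem_ofPred_eq, dist_eq_norm, norm_sub_rev q p] using this
  set D := ‖q - p‖ with hDdef
  have hD0 : 0 < D := by
    obtain ⟨x, hx⟩ := hne
    obtain ⟨r, hr, hball⟩ := Metric.isOpen_iff.1 hΩ x hx
    have hy : x + EuclideanSpace.single 0 (r / 2) ∈ Ω := hball (by
      rw [mem_ball_iff_norm]; simp [abs_of_pos hr]; linarith)
    have := hD _ (subset_closure hy) x (subset_closure hx)
    simp [abs_of_pos hr] at this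
    linarith
  set e : R2 := D⁻¹ • (q - p) with hedef
  have he : ‖e‖ = 1 := by
    rw [hedef, norm_smul, norm_inv, norm_norm]
    exact inv_mul_cancel₀ hD0.ne'
  have hqp : q - p = D • e := by rw [hedef, smul_inv_smul₀ hD0.ne']
  have hν : ‖quarterTurn e‖ = 1 := (norm_quarterTurn e).trans he
  set ν := quarterTurn e with hνdef
  have hcont : ContinuousOn (fun x : R2 => inner ℝ ν x) (closure Ω) := by fun_prop
  obtain ⟨xa, hxa, ha⟩ := hK.exists_isMinOn hKne hcont
  obtain ⟨xb, hxb, hbb⟩ := hK.exists_isMaxOn hKne hcont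
  have hstrip : ∀ x ∈ closure Ω, inner ℝ ν x ∈ Icc (inner ℝ ν xa) (inner ℝ ν xb) :=
    fun x hx => ⟨ha hx, hbb hx⟩
  set a : ℝ := inner ℝ ν xa
  set b : ℝ := inner ℝ ν xb
  have hepq : inner ℝ e q - inner ℝ e p = D := by
    rw [← inner_sub_right, hqp, real_inner_smul_right, real_inner_self_eq_norm_sq, he]
    ring
  have hle : ∀ x ∈ closure Ω, ∀ y ∈ closure Ω, ∀ n : R2, ‖n‖ = 1 →
      inner ℝ n x - inner ℝ n y ≤ D := fun x hx y hy n hn => by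
    rw [← inner_sub_right]
    refine (real_inner_le_norm _ _).trans ?_
    rw [hn, one_mul]
    exact hD x hx y hy
  have hsub : Ω ⊆ rectangle e (inner ℝ e p) (inner ℝ e q) a b := fun x hx => by
    have hx' := subset_closure hx
    refine ⟨⟨?_, ?_⟩, hstrip x hx'⟩
    · linarith [hle q hq x hx' e he]
    · linarith [hle x hx' p hp e he]
  have hab : a < b := by
    obtain ⟨x, hx⟩ := hne
    obtain ⟨r, hr, hball⟩ := Metric.isOpen_iff.1 hΩ x hx
    have hy : x + (r / 2) • ν ∈ Ω := hball (by
      rw [mem_ball_iff_norm]; simp [norm_smul, hν, abs_of_pos hr, hr])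
    have h1 := (hstrip _ (subset_closure hy)).2
    have h2 := (hstrip _ (subset_closure hx)).1
    rw [inner_add_right, real_inner_smul_right, real_inner_self_eq_norm_sq, hν] at h1
    linarith
  have harea : ∀ w ∈ closure Ω, D * |inner ℝ ν w - inner ℝ ν p| ≤ 2 * volume.real Ω := by
    intro w hw
    have h1 := hKc.abs_det_div_two_le_volume hp hq hw
    have h2 : volume (closure Ω) = volume Ω := by
      refine le_antisymm ?_ (measure_mono subset_closure)
      rw [closure_eq_self_union_frontier]
      refine (measure_union_le _ _).trans ?_
      rw [hc.addHaar_frontier volume, add_zero]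
    have h3 : inner ℝ (quarterTurn (q - p)) (w - p) = D * (inner ℝ ν w - inner ℝ ν p) := by
      rw [hqp, hνdef]
      simp [inner_eq, quarterTurn]
      ring
    rw [h2, h3, abs_mul, abs_of_pos hD0] at h1
    have h4 := ENNReal.toReal_mono (ENNReal.mul_ne_top ENNReal.ofNat_ne_top
      hb.measure_lt_top.ne) h1
    rwa [ENNReal.toReal_ofReal (by positivity), ENNReal.toReal_mul, ENNReal.toReal_ofNat] at h4
  refine ⟨ν, a, b, D, hν, fun x hx => hstrip x (subset_closure hx), sub_pos.2 hab,
    hle xb hxb xa hxa ν hν, ?_, ?_⟩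
  · have h1 := harea xa hxa
    have h2 := harea xb hxb
    have h3 := neg_abs_le (inner ℝ ν xa - inner ℝ ν p)
    have h4 := le_abs_self (inner ℝ ν xb - inner ℝ ν p)
    have h5 : b - a ≤ |inner ℝ ν xa - inner ℝ ν p| + |inner ℝ ν xb - inner ℝ ν p| := by
      linarith
    nlinarith [mul_le_mul_of_nonneg_left h5 hD0.le]
  · refine ENNReal.toReal_le_of_le_ofReal (by linarith) ?_
    refine (hc.hausdorffMeasure_frontier_le hΩ hne (isCompact_rectangle he _ _ _ _) hsub
      zero_le_one).trans ?_
    refine (hausdorffMeasure_frontier_rectangle_le he (by linarith) hab.le).trans ?_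
    rw [hepq]

lemma exists_isSolP_of_strip {Ω : Set R2} (hΩ : IsOpen Ω) (hb : Bornology.IsBounded Ω)
    (hc : Convex ℝ Ω) {ν : R2} (hν : ‖ν‖ = 1) {a b lam : ℝ}
    (hO : ∀ x ∈ Ω, a ≤ inner ℝ ν x ∧ inner ℝ ν x ≤ b) (hlam : 0 < lam)
    (hA : 0 < volume.real Ω)
    (hB : lam / volume.real Ω * exp (1 / 2) * (b - a) ^ 2 / 8 < 1 / 2) :
    ∃ u : R2 → ℝ, IsSolP Ω lam u := by
  set A := volume.real Ω with hAdef
  have hμ₁ : 0 ≤ lam / A := by positivity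
  obtain ⟨u, C, C', hC0, hu⟩ := exists_weak_solution_family hΩ hb hc hν hO hμ₁ hB
  have hfin : volume Ω ≠ ⊤ := hb.measure_lt_top.ne
  have hcont : ∀ μ ∈ Icc 0 (lam / A), Continuous (u μ) := fun μ hμ => by
    refine (LipschitzWith.of_dist_le_mul (K := ⟨C, hC0⟩) fun x y => ?_).continuous
    rw [Real.dist_eq, dist_eq_norm]; exact (hu μ hμ).2.2.1 x y
  have hexp : ∀ μ ∈ Icc 0 (lam / A), ∀ x, |exp (u μ x)| ≤ exp (1 / 2) := fun μ hμ x => by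
    rw [abs_of_pos (exp_pos _)]
    exact exp_le_exp.2 ((hu μ hμ).1 x).2
  have hintg : ∀ μ ∈ Icc 0 (lam / A), IntegrableOn (fun x => exp (u μ x)) Ω := fun μ hμ => by
    refine Measure.integrableOn_of_bounded (M := exp (1 / 2)) hfin ?_ ?_
    · exact (continuous_exp.comp (hcont μ hμ)).aestronglyMeasurable
    · exact Eventually.of_forall fun x => hexp μ hμ x
  have hIcont : ContinuousOn (fun μ => ∫ x in Ω, exp (u μ x)) (Icc 0 (lam / A)) := by
    refine (LipschitzOnWith.of_dist_le_mul (K := ⟨exp (1 / 2) * |C'| * A, by positivity⟩)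
      fun μ hμ μ' hμ' => ?_).continuousOn
    rw [dist_eq_norm, ← integral_sub (hintg μ hμ) (hintg μ' hμ')]
    have h1 := norm_setIntegral_le_of_norm_le_const (μ := volume) (s := Ω)
      (C := exp (1 / 2) * (|C'| * |μ - μ'|))
      (f := fun x => exp (u μ x) - exp (u μ' x)) hb.measure_lt_top fun x _ => by
        refine (abs_exp_sub_exp_le ((hu μ hμ).1 x).2 ((hu μ' hμ').1 x).2).trans ?_
        refine mul_le_mul_of_nonneg_left ?_ (exp_pos _).le
        refine ((hu μ hμ).2.2.2.1 μ' hμ' x).trans ?_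
        gcongr
        exact le_abs_self C'
    refine h1.trans (le_of_eq ?_)
    rw [Real.dist_eq]
    change _ = exp (1 / 2) * |C'| * A * |μ - μ'|
    ring
  have hge : A ≤ ∫ x in Ω, exp (u (lam / A) x) := by
    have hm := right_mem_Icc.2 hμ₁
    have h1 : ∫ _ in Ω, (1 : ℝ) ≤ ∫ x in Ω, exp (u (lam / A) x) :=
      setIntegral_mono (integrableOn_const hfin) (hintg _ hm)
        fun x => one_le_exp ((hu _ hm).1 x).1
    simpa [hAdef] using h1
  obtain ⟨μ, hμ, hμeq⟩ := intermediate_value_Icc hμ₁ (continuousOn_id.mul hIcont)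
    (show lam ∈ Icc _ _ from ⟨by simpa using hlam.le, by
      simp only [Pi.mul_apply, id]
      calc lam = lam / A * A := by field_simp
        _ ≤ _ := by gcongr⟩)
  obtain ⟨hmem, hzero, hlip, -, hw⟩ := hu μ hμ
  have hμ0 := hμ.1
  obtain ⟨hreg, heq⟩ := contDiffOn_of_weak hΩ (f := fun x => μ * exp (u μ x)) (L' := μ * exp (1 / 2) * C)
    (B := μ * exp (1 / 2)) hC0 hlip
    (fun x => by
      rw [abs_mul, abs_of_nonneg hμ0]
      exact mul_le_mul_of_nonneg_left (hexp μ hμ x) hμ0)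
    (by positivity)
    (fun x y => by
      rw [← mul_sub, abs_mul, abs_of_nonneg hμ0, mul_assoc, mul_assoc]
      refine mul_le_mul_of_nonneg_left ?_ hμ0
      refine (abs_exp_sub_exp_le (hmem x).2 (hmem y).2).trans ?_
      exact mul_le_mul_of_nonneg_left (hlip x y) (exp_pos _).le)
    hw
  refine ⟨u μ, hreg, (hcont μ hμ).continuousOn, fun p hp => hzero p ?_, fun p hp => ?_⟩
  · rw [hΩ.frontier_eq] at hp
    exact hp.2
  · rw [heq p hp]
    simp only [Pi.mul_apply, id] at hμeq
    have hI : ∫ x in Ω, exp (u μ x) ≠ 0 := fun h => by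
      rw [h, mul_zero] at hμeq
      exact hlam.ne hμeq
    rw [← hμeq]
    field_simp

/-- There are `N̄ > 4π` and `C > 0` such that every open bounded convex `Ω ⊂ ℝ²` with
`N(Ω) ≥ N̄` admits a solution of `P(λ,Ω)` for every
`λ ∈ (0, max(8π, π²N(Ω)/496 − C)]`. -/
theorem statement1 :
    ∃ Nbar C : ℝ, 4 * π < Nbar ∧ 0 < C ∧
      ∀ Ω : Set R2, IsOpen Ω → Bornology.IsBounded Ω → Convex ℝ Ω →
        Nbar ≤ isoRatio Ω →
        ∀ lam ∈ Set.Ioc (0 : ℝ) (max (8 * π) (π ^ 2 * isoRatio Ω / 496 - C)),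
          ∃ u : R2 → ℝ, IsSolP Ω lam u := by
  have hπ := pi_gt_three
  have hπ' := pi_lt_d2
  refine ⟨3000, 1, by linarith, one_pos, fun Ω hΩ hb hc hN lam hlam => ?_⟩
  have hne : Ω.Nonempty := by
    rw [nonempty_iff_ne_empty]
    rintro rfl
    simp [isoRatio] at hN
    linarith
  obtain ⟨ν, a, b, D, hν, hO, hH, hHD, hA, hL⟩ := exists_strip hΩ hb hc hne
  have hD : 0 < D := hH.trans_le hHD
  have hA0 : 0 < volume.real Ω := lt_of_lt_of_le (by positivity) hA
  refine exists_isSolP_of_strip hΩ hb hc hν hO hlam.1 hA0 ?_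
  have hlam' : lam ≤ π ^ 2 * isoRatio Ω / 496 := by
    refine hlam.2.trans (max_le ?_ (by linarith))
    nlinarith
  set N := isoRatio Ω with hNdef
  set A := volume.real Ω with hAdef
  set L := (μH[1] (frontier Ω)).toReal
  set H := b - a
  have hL0 : 0 ≤ L := ENNReal.toReal_nonneg
  have hNA : N * A = L ^ 2 := div_mul_cancel₀ _ hA0.ne'
  have hthin : 3000 * H ≤ 64 * D := by
    have h1 : 3000 * A ≤ L ^ 2 := hNA ▸ mul_le_mul_of_nonneg_right hN hA0.le
    have h2 : L ^ 2 ≤ (4 * D) ^ 2 := pow_le_pow_left₀ hL0 (by linarith) 2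
    have h3 : D * (3000 * H) ≤ D * (64 * D) := by nlinarith
    exact le_of_mul_le_mul_left h3 hD
  have hLH : L * H ≤ 8.2 * A := by
    have h1 : L ≤ 2.05 * D := by linarith
    nlinarith [mul_le_mul_of_nonneg_right h1 hH.le]
  have hNH : N * H ^ 2 ≤ 68 * A := by
    have h1 : (L * H) ^ 2 ≤ (8.2 * A) ^ 2 := pow_le_pow_left₀ (by positivity) hLH 2
    have h2 : (N * H ^ 2) * A ≤ (68 * A) * A := by
      have : (N * H ^ 2) * A = (L * H) ^ 2 := by rw [mul_pow, ← hNA]; ring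
      nlinarith [mul_pos hA0 hA0]
    exact le_of_mul_le_mul_right h2 hA0
  have hexp : exp (1 / 2) < 2 := by
    have h1 : exp (1 / 2) * exp (1 / 2) = exp 1 := by rw [← exp_add]; norm_num
    nlinarith [exp_one_lt_d9, exp_pos (1 / 2 : ℝ)]
  have hlamH : lam * H ^ 2 ≤ 1.4 * A := by
    have h1 : lam * H ^ 2 ≤ π ^ 2 * N / 496 * H ^ 2 := by gcongr
    have h2 : π ^ 2 ≤ 10 := by nlinarith
    have h3 : π ^ 2 * (N * H ^ 2) ≤ 10 * (68 * A) :=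
      mul_le_mul h2 hNH (by positivity) (by norm_num)
    linarith
  have hrw : lam / A * exp (1 / 2) * H ^ 2 / 8 = (lam * H ^ 2) / A * exp (1 / 2) / 8 := by ring
  have hq : lam * H ^ 2 / A ≤ 1.4 := (div_le_iff₀ hA0).2 hlamH
  have := mul_le_mul hq hexp.le (exp_pos _).le (by norm_num)
  rw [hrw]
  linarith
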